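/- arXiv:2304.11475 — 2 statements merged into one kernel-verified Lean document; each statement's English description precedes it below -/
import Mathlib

section
/- Let C be a finitely generated bifiltered chain complex over 𝔽₂ with a ℤ-valued Maslov grading gr for which the differential ∂ is homogeneous of degree −1, and let B be a basis of C consisting of gr-homogeneous elements such that the graph on B, with an edge between two basis elements whenever one appears in the differential of the other, is connected. Suppose some filtered change of basis carries B to the standard set of generators of either (i) the direct sum of a positive staircase and a box of length 1, or (ii) a positive almost staircase. Then the elements of B lie in either 3 or 4 consecutive Maslov gradings, and the numbers of elements of B in each grading, listed from highest to lowest, form one of the patterns (1,∗,∗), (∗,∗,1), (1,2,∗,∗), (∗,∗,2,1), where each ∗ is some positive integer. (This is the content of Lemma 3.4 of the paper, with the Floer-theoretic hypothesis that the diagram represents an almost L-space knot replaced by its algebraic consequence.) -/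
/-!
Common combinatorial framework for standard (1,1) diagrams in Rasmussen standard
form, their lifts to the universal cover of the torus, and the combinatorial knot
Floer chain complexes they define.
-/

namespace OneOneKnot

open scoped Classical

noncomputable section

/-- A state in the traversal of the lifts of the `β` curve of a standard (1,1) diagram
to the universal cover `ℝ²` of the torus.  `pos` is the position coordinate of an
intersection point of `β` with a lift of `α`; `up` records whether `β` crosses that
lift of `α` upwards (with respect to the reference orientation of `β`); `top` records
whether `pos` is measured as a top-edge or a bottom-edge coordinate of the
corresponding fundamental rectangle; `ht` is the index of the lift of `α` (the line
`y = ht`). -/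
structure CState where
  pos : ℤ
  up : Bool
  top : Bool
  ht : ℤ

/-- The data of a standard (1,1) diagram in Rasmussen standard form, encoded by a
four-tuple `(p, q, r, s)` with `q, r ≥ 0`, `2q + r ≤ p` and `0 ≤ s < p`. -/
structure StdDiagram where
  p : ℕ
  q : ℕ
  r : ℕ
  s : ℕ
  hp : 0 < p
  h2qr : 2 * q + r ≤ p
  hs : s < p

namespace StdDiagram

variable (D : StdDiagram)

def pz : ℤ := D.p
def qz : ℤ := D.q
def rz : ℤ := D.r
def sz : ℤ := D.s

/-- One step forward along (a lift of) `β`, with respect to a reference orientation of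
`β`.  This is Algorithm 1 of the paper: rainbow arcs occupy top-edge positions
`r, …, r + 2q - 1` and bottom-edge positions `0, …, 2q - 1` (mod `p`), the `i`-th
point of the top edge is identified with the `(i+s)`-th point of the bottom edge, and
`ht` records the line `y = ht` of the universal cover on which the point lies. -/
def step (σ : CState) : CState :=
  let m := σ.pos % D.pz
  if σ.top then
    if σ.up then ⟨σ.pos + D.sz, σ.up, false, σ.ht⟩
    else if m ≤ D.rz - 1 then ⟨σ.pos + 2 * D.qz, σ.up, false, σ.ht - 1⟩
    else if m ≤ D.rz + 2 * D.qz - 1 then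
      ⟨2 * D.rz + 2 * D.qz - 1 - 2 * m + σ.pos, true, true, σ.ht⟩
    else ⟨σ.pos, σ.up, false, σ.ht - 1⟩
  else
    if σ.up = false then ⟨σ.pos - D.sz, σ.up, true, σ.ht⟩
    else if m ≤ 2 * D.qz - 1 then ⟨2 * D.qz - 1 - 2 * m + σ.pos, false, false, σ.ht⟩
    else if m ≤ D.rz + 2 * D.qz - 1 then ⟨σ.pos - 2 * D.qz, σ.up, true, σ.ht + 1⟩
    else ⟨σ.pos, σ.up, true, σ.ht + 1⟩

/-- One step backward along `β` (the inverse of `step`). -/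
def stepB (σ : CState) : CState :=
  let m := σ.pos % D.pz
  if σ.top then
    if σ.up then
      if D.rz ≤ m ∧ m ≤ D.rz + 2 * D.qz - 1 then
        ⟨2 * D.rz + 2 * D.qz - 1 - 2 * m + σ.pos, false, true, σ.ht⟩
      else if m ≤ D.rz - 1 then ⟨σ.pos + 2 * D.qz, true, false, σ.ht - 1⟩
      else ⟨σ.pos, true, false, σ.ht - 1⟩
    else ⟨σ.pos + D.sz, false, false, σ.ht⟩
  else
    if σ.up then ⟨σ.pos - D.sz, true, true, σ.ht⟩
    else
      if m ≤ 2 * D.qz - 1 then ⟨2 * D.qz - 1 - 2 * m + σ.pos, true, false, σ.ht⟩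
      else if m ≤ 2 * D.qz + D.rz - 1 then ⟨σ.pos - 2 * D.qz, false, true, σ.ht + 1⟩
      else ⟨σ.pos, false, true, σ.ht + 1⟩

/-- Reference starting state: the intersection point with top-edge coordinate `0`
on the line `y = 0`. -/
def start0 : CState := ⟨0, false, true, 0⟩

/-- `β` is a single closed curve: its traversal passes through all `p`
intersection points with `α`. -/
def Connected : Prop :=
  ∀ k : ℕ, k < D.p → ∃ n : ℕ,
    ((D.step)^[n] start0).top = true ∧ ((D.step)^[n] start0).pos % D.pz = (k : ℤ)

/-- `β` crosses the intersection point with top-edge coordinate `≡ k (mod p)`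
upwards, with respect to the reference orientation of `β`. -/
def UpAt (k : ℤ) : Prop :=
  ∃ n : ℕ, ((D.step)^[n] start0).top = true ∧
    ((D.step)^[n] start0).pos % D.pz = k % D.pz ∧ ((D.step)^[n] start0).up = true

/-- The algebraic intersection number `α · β` computed with the reference
orientation of `β` (and `α` oriented from left to right). -/
def algInt : ℤ := ∑ k ∈ Finset.range D.p, (if D.UpAt (k : ℤ) then (1 : ℤ) else -1)

/-- One step forward along `β` for the orientation of `β` normalised so that
`α · β > 0`. -/
def fstep (σ : CState) : CState := if 0 < D.algInt then D.step σ else D.stepB σ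

/-- With the normalised orientation, `β` crosses `α` upwards at the given state. -/
def TrueUp (σ : CState) : Prop := (0 < D.algInt ↔ σ.up = true)

/-- With the normalised orientation, `β` crosses the intersection point with
top-edge coordinate `≡ k (mod p)` upwards. -/
def TrueUpPt (k : ℤ) : Prop := (0 < D.algInt ↔ D.UpAt k)

/-- The canonical state sitting at the intersection point `k` on the line `y = 0`
(of the chosen lift `α̃` of `α`). -/
def spt (k : ℕ) : CState := ⟨(k : ℤ), if D.UpAt (k : ℤ) then true else false, true, 0⟩

/-- The state is an intersection point of `β̃` with the line `y = 0`
(recorded with its canonical top-edge coordinate). -/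
def IsCross0 (σ : CState) : Prop := σ.top = true ∧ σ.ht = 0

/-- The portion of `β̃` after `σ` returns to the line `y = 0`; that is, `σ` is the
starting point of a compact arc cut off by `α̃` rather than of a ray. -/
def Returns0 (σ : CState) : Prop := ∃ n : ℕ, 1 ≤ n ∧ IsCross0 ((D.fstep)^[n] σ)

/-- Number of `fstep`-moves until the next intersection with the line `y = 0`. -/
def ret0Steps (σ : CState) : ℕ := sInf {n : ℕ | 1 ≤ n ∧ IsCross0 ((D.fstep)^[n] σ)}

/-- The next intersection point of `β̃` with the line `y = 0` after `σ`. -/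
def nxt0 (σ : CState) : CState := (D.fstep)^[D.ret0Steps σ] σ

/-- The label (downstairs intersection point) of a state. -/
def lab (σ : CState) : ℤ := σ.pos % D.pz

/-- The compact arc of `β̃` starting at the intersection point `k` of the line
`y = 0` is oriented rightward (for the normalised orientation of `β`). -/
def ArcRight (k : ℕ) : Prop := (k : ℤ) < (D.nxt0 (D.spt k)).pos

/-- Starting points of the compact arcs in the upper half-plane cut off by `α̃`
from the union of the lifts `β̃ₛ`. -/
def UpperStarts : Finset ℕ :=
  (Finset.range D.p).filter fun k => D.Returns0 (D.spt k) ∧ D.TrueUp (D.spt k)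

/-- Starting points of the compact arcs in the lower half-plane. -/
def LowerStarts : Finset ℕ :=
  (Finset.range D.p).filter fun k => D.Returns0 (D.spt k) ∧ ¬ D.TrueUp (D.spt k)

/-- The number of compact arcs in the upper half-plane with orientation `b`
(`true` = rightward, `false` = leftward). -/
def uCnt (b : Bool) : ℕ := (D.UpperStarts.filter fun k => D.ArcRight k ↔ b = true).card

/-- The number of compact arcs in the lower half-plane with orientation `b`. -/
def lCnt (b : Bool) : ℕ := (D.LowerStarts.filter fun k => D.ArcRight k ↔ b = true).card

/-- Definition 3.2: the standard diagram is *virtually almost coherent* if, for an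
admissible choice of inconsistent direction in each half-plane (the inconsistent
direction must be carried by at most as many arcs as the other direction), the
union of the lifts `β̃ₛ` contains exactly two inconsistent arcs. -/
def VirtuallyAlmostCoherent : Prop :=
  ∃ dU dL : Bool,
    D.uCnt dU ≤ D.uCnt (!dU) ∧ D.lCnt dL ≤ D.lCnt (!dL) ∧ D.uCnt dU + D.lCnt dL = 2

/-- `k` is the starting point of one of the two inconsistent arcs, for the choice
`(dU, dL)` of inconsistent directions in the upper and lower half-planes. -/
def InconsCoverArc (dU dL : Bool) (k : ℕ) : Prop :=
  (k ∈ D.UpperStarts ∧ (D.ArcRight k ↔ dU = true)) ∨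
  (k ∈ D.LowerStarts ∧ (D.ArcRight k ↔ dL = true))

/-! ### Rainbow arcs of the diagram downstairs -/

/-- The rainbow arcs of the standard diagram: `(true, i)` with `r ≤ i < r + q` is the
rainbow arc attached to the top edge with feet `i` and `2r + 2q - 1 - i`; `(false, j)`
with `j < q` is the rainbow arc attached to the bottom edge with feet `j` and
`2q - 1 - j`.  The two families are the rainbow arcs around the two basepoints. -/
def rainbowArcs : Finset (Bool × ℕ) :=
  ((Finset.Ico D.r (D.r + D.q)).image fun i => ((true : Bool), i)) ∪
    ((Finset.range D.q).image fun j => ((false : Bool), j))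

/-- The two endpoints of a rainbow arc, as intersection points of `α ∩ β` recorded
by their top-edge coordinates in `ZMod p`. -/
def rEnds (a : Bool × ℕ) : Finset (ZMod D.p) :=
  if a.1 then
    {((a.2 : ℤ) : ZMod D.p), ((2 * D.rz + 2 * D.qz - 1 - (a.2 : ℤ) : ℤ) : ZMod D.p)}
  else
    {(((a.2 : ℤ) - D.sz : ℤ) : ZMod D.p), ((2 * D.qz - 1 - (a.2 : ℤ) - D.sz : ℤ) : ZMod D.p)}

/-- A rainbow arc is oriented rightward (with the normalised orientation of `β`):
a top-edge rainbow arc is traversed starting from the endpoint where `β` crosses `α`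
downwards, a bottom-edge one from the endpoint where `β` crosses `α` upwards. -/
def rOrientRight (a : Bool × ℕ) : Prop :=
  if a.1 then ¬ D.TrueUpPt (a.2 : ℤ) else D.TrueUpPt ((a.2 : ℤ) - D.sz)

/-- The number of rainbow arcs in the family `f` (`true` = attached to the top edge)
with orientation `b` (`true` = rightward). -/
def famCnt (f : Bool) (b : Bool) : ℕ :=
  (D.rainbowArcs.filter fun a => a.1 = f ∧ (D.rOrientRight a ↔ b = true)).card

/-- `a` is an inconsistent rainbow arc for the choice `(dT, dB)` of inconsistent
directions for the two families. -/
def InconsArc (dT dB : Bool) (a : Bool × ℕ) : Prop :=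
  a ∈ D.rainbowArcs ∧ (D.rOrientRight a ↔ (if a.1 then dT else dB) = true)

/-- Two rainbow arcs share a common endpoint. -/
def ShareEnd (a b : Bool × ℕ) : Prop := ((D.rEnds a) ∩ (D.rEnds b)).Nonempty

/-- Two rainbow arcs are connected to each other by two other rainbow arcs. -/
def ConnectedByTwo (a1 a2 : Bool × ℕ) : Prop :=
  ∃ b1 b2 : Bool × ℕ, b1 ∈ D.rainbowArcs ∧ b2 ∈ D.rainbowArcs ∧
    b1 ≠ a1 ∧ b1 ≠ a2 ∧ b2 ≠ a1 ∧ b2 ≠ a2 ∧ b1 ≠ b2 ∧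
    D.ShareEnd a1 b1 ∧ D.ShareEnd b1 b2 ∧ D.ShareEnd b2 a2

/-- Definition 1.2: the standard diagram is *strongly almost coherent* if, for an
admissible choice of inconsistent directions, there are exactly two inconsistent
rainbow arcs, and either they share a common endpoint, or they are connected to each
other by two other rainbow arcs. -/
def StronglyAlmostCoherent : Prop :=
  ∃ dT dB : Bool,
    D.famCnt true dT ≤ D.famCnt true (!dT) ∧ D.famCnt false dB ≤ D.famCnt false (!dB) ∧
    ∃ a1 a2 : Bool × ℕ, a1 ≠ a2 ∧ (∀ a, D.InconsArc dT dB a ↔ (a = a1 ∨ a = a2)) ∧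
      (D.ShareEnd a1 a2 ∨ D.ConnectedByTwo a1 a2)

/-! ### Spin^c classes of intersection points -/

/-- The point `l` is reached from the point `k` by travelling forward along the lift
`β̃` through (the lift at height `0` of) `k`, meeting it on the line `y = 0`. -/
def Reach (k l : ℕ) : Prop :=
  ∃ n : ℕ, IsCross0 ((D.fstep)^[n] (D.spt k)) ∧
    ((D.fstep)^[n] (D.spt k)).pos % D.pz = (l : ℤ)

/-- Two intersection points are in the same class (i.e. they induce the same
spin^c structure): some lift of `β` meeting the line `y = 0` passes through lifts
of both of them on that line. -/
def SameClass (k l : ℕ) : Prop := D.Reach k l ∨ D.Reach l k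

/-! ### The sequence of intersection points along a lift -/

/-- The `m`-th intersection point of `β̃ₛ` with the line `y = 0` after the point `c`. -/
def seqSt (c m : ℕ) : CState := (D.nxt0)^[m] (D.spt c)

/-- Its label downstairs. -/
def labAt (c m : ℕ) : ℤ := D.lab (D.seqSt c m)

/-- Its position coordinate on the line `y = 0`. -/
def posAt (c m : ℕ) : ℤ := (D.seqSt c m).pos

/-- The differential component carried by the compact arc starting at `k` points
from the starting point of the arc towards its end point.  (For an arc in the upper
half-plane the source of the arrow is the right endpoint, for an arc in the lower
half-plane it is the left endpoint.) -/
def srcIsStart (k : ℕ) : Prop :=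
  ¬ (D.TrueUp (D.spt k) ↔ (k : ℤ) < (D.nxt0 (D.spt k)).pos)

/-- The label of the source of the differential component carried by the arc
starting at `k`. -/
def srcLab (k : ℕ) : ℤ :=
  if D.srcIsStart k then (k : ℤ) % D.pz else (D.nxt0 (D.spt k)).pos % D.pz

/-- The label of the target of the differential component carried by the arc
starting at `k`. -/
def tgtLab (k : ℕ) : ℤ :=
  if D.srcIsStart k then (D.nxt0 (D.spt k)).pos % D.pz else (k : ℤ) % D.pz

/-- The number of bigons (compact arcs) inducing a differential component from `x`
to `y`. -/
def arrowCnt (x y : ℕ) : ℕ :=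
  ((Finset.range D.p).filter fun k =>
    D.Returns0 (D.spt k) ∧ D.srcLab k = (x : ℤ) ∧ D.tgtLab k = (y : ℤ)).card


/-! ### Counting basepoints inside the bigon cut off by a compact arc -/

/-- Doubled plane `x`-coordinate of a state in the (sheared) universal cover. -/
def x2 (σ : CState) : ℤ := 2 * σ.pos - 2 * D.sz * (if σ.top then σ.ht - 1 else σ.ht)

/-- The number of crossings of the upward vertical ray emanating from the basepoint
slot in row `ρ` with doubled `x`-coordinate `X0` (a `w`-slot if `isZ = false`, sitting
just above the line `y = ρ`; a `z`-slot if `isZ = true`, sitting just below the line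
`y = ρ + 1`) with the piece of `β̃` between the state `σ` and the next state. -/
def rayCross (σ : CState) (X0 ρ : ℤ) (isZ : Bool) : ℕ :=
  let σ' := D.fstep σ
  let lo := min (D.x2 σ) (D.x2 σ')
  let hi := max (D.x2 σ) (D.x2 σ')
  if σ.ht ≠ σ'.ht then
    -- a strand crossing the row between the lines `y = min ht` and `y = min ht + 1`
    (if (ρ < min σ.ht σ'.ht ∨ (ρ = min σ.ht σ'.ht ∧ isZ = false)) ∧ lo < X0 ∧ X0 < hi
      then 1 else 0)
  else if σ.top = σ'.top then
    if σ.top then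
      -- a rainbow arch hanging below the line `y = σ.ht`
      (if (if isZ then ρ ≤ σ.ht - 2 else ρ ≤ σ.ht - 1) ∧ lo < X0 ∧ X0 < hi then 1 else 0)
    else
      -- a rainbow arch sitting above the line `y = σ.ht`
      (if (if isZ then ρ ≤ σ.ht - 1 else ρ ≤ σ.ht) ∧ lo < X0 ∧ X0 < hi then 1 else 0)
  else 0

/-- Doubled plane `x`-coordinate of the basepoint slot of row `ρ`, horizontal
translate `m`: the `w`-basepoint is between bottom-edge coordinates `q - 1` and `q`,
the `z`-basepoint between top-edge coordinates `r + q - 1` and `r + q`. -/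
def slotX2 (ρ m : ℤ) (isZ : Bool) : ℤ :=
  (if isZ then 2 * (D.rz + D.qz) - 1 else 2 * D.qz - 1) - 2 * ρ * D.sz + 2 * m * D.pz

/-- The states traversed by the compact arc starting at the intersection point `k`. -/
def arcState (k i : ℕ) : CState := (D.fstep)^[i] (D.spt k)

/-- Number of crossings of the upward vertical ray from a slot with the chord of the
bigon (the segment of the line `y = 0` joining the endpoints of the arc). -/
def chordCross (k : ℕ) (X0 ρ : ℤ) : ℕ :=
  if ρ ≤ -1 ∧ min (D.x2 (D.spt k)) (D.x2 (D.nxt0 (D.spt k))) < X0 ∧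
      X0 < max (D.x2 (D.spt k)) (D.x2 (D.nxt0 (D.spt k))) then 1 else 0

/-- A basepoint slot lies inside the (embedded) bigon cobounded by the compact arc
starting at `k` and the line `y = 0`: the upward vertical ray from the slot meets the
boundary of the bigon an odd number of times. -/
def SlotInBigon (k : ℕ) (ρ m : ℤ) (isZ : Bool) : Prop :=
  ¬ (2 ∣ ((D.chordCross k (D.slotX2 ρ m isZ) ρ : ℤ) +
      ∑ i ∈ Finset.range (D.ret0Steps (D.spt k)),
        (D.rayCross (D.arcState k i) (D.slotX2 ρ m isZ) ρ isZ : ℤ)))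

/-- A bound for the rows met by the arc starting at `k`. -/
def hBound (k : ℕ) : ℕ :=
  ((Finset.range (D.ret0Steps (D.spt k) + 1)).sup fun i => (D.arcState k i).ht.natAbs) + 2

/-- A bound for the horizontal translates of slots met by the arc starting at `k`. -/
def mBound (k : ℕ) : ℕ :=
  ((Finset.range (D.ret0Steps (D.spt k) + 1)).sup fun i => (D.arcState k i).pos.natAbs)
    + (D.hBound k + 2) * (D.s + 1) + D.p + D.q + D.r + 4

/-- The number of lifts of the `w`-basepoint (`isZ = false`), respectively of the
`z`-basepoint (`isZ = true`), inside the bigon cobounded by the compact arc starting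
at `k` and the line `y = 0`. -/
def arcBase (k : ℕ) (isZ : Bool) : ℕ :=
  (((Finset.Icc (-(D.hBound k : ℤ)) (D.hBound k)) ×ˢ
      (Finset.Icc (-(D.mBound k : ℤ)) (D.mBound k))).filter
    fun ρm => D.SlotInBigon k ρm.1 ρm.2 isZ).card

/-- The arc starting at `k` stays within the two rows adjacent to the line `y = 0`
(equivalently, it has height `< 1`). -/
def ArcWithinRow (k : ℕ) : Prop :=
  ∀ n : ℕ, n ≤ D.ret0Steps (D.spt k) → (D.arcState k n).ht = 0

/-- The arc starting at `k` is a lift of a single rainbow arc of the diagram. -/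
def ArcIsRainbowLift (k : ℕ) : Prop := D.ret0Steps (D.spt k) = 3

/-! ### Gradings and filtrations of the knot Floer complex -/

/-- The relative Maslov grading changes by `±1` along each arc, dropping (by `1`)
from the source of its differential component to the target. -/
def grStep (k : ℕ) : ℤ := if D.srcIsStart k then -1 else 1

/-- The relative `i`-filtration drops, from the source of the differential component
carried by an arc to the target, by the number of `w`-basepoints in its bigon. -/
def faStep (k : ℕ) : ℤ := (if D.srcIsStart k then -1 else 1) * (D.arcBase k false : ℤ)

/-- The relative `j`-filtration drops by the number of `z`-basepoints in the bigon. -/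
def fbStep (k : ℕ) : ℤ := (if D.srcIsStart k then -1 else 1) * (D.arcBase k true : ℤ)

/-- The sum of the per-arc increments of a relative grading along the first `m` arcs
of the lift `β̃` starting at the point `c`. -/
def pathSum (f : ℕ → ℤ) (c m : ℕ) : ℤ := ∑ i ∈ Finset.range m, f (D.labAt c i).toNat

/-- `a` occurs in the forward sequence of intersection points of `β̃` with the line
`y = 0` starting at `c`. -/
def ReachIn (c a : ℕ) : Prop := ∃ m : ℕ, D.labAt c m = (a : ℤ)

/-- The value at `a` of the relative grading with per-arc increments `f`, normalised
to vanish at the base point `c` of the class. -/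
def relOf (f : ℕ → ℤ) (c a : ℕ) : ℤ :=
  if h : D.ReachIn c a then D.pathSum f c (Nat.find h)
  else if h' : D.ReachIn a c then - D.pathSum f a (Nat.find h') else 0

/-- The Maslov grading of the generator `a` of the class of `c` (normalised at `c`). -/
def grOf (c a : ℕ) : ℤ := D.relOf D.grStep c a

/-- The `i`-filtration of the generator `a` of the class of `c`. -/
def faOf (c a : ℕ) : ℤ := D.relOf D.faStep c a

/-- The `j`-filtration of the generator `a` of the class of `c`. -/
def fbOf (c a : ℕ) : ℤ := D.relOf D.fbStep c a

/-- The number of generators of the class of `c` in Maslov grading `g`. -/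
def grCountClass (c : ℕ) (g : ℤ) : ℕ :=
  ((Finset.range D.p).filter fun a => D.SameClass a c ∧ D.grOf c a = g).card

/-! ### Turning points -/

/-- The differential component of the arc from the `i`-th to the `(i+1)`-st point of
the sequence along `β̃ₛ` starting at `c` points forward. -/
def srcIsStartAt (c i : ℕ) : Prop := D.srcIsStart (D.labAt c i).toNat

/-- The cumulative relative Maslov grading of the `m`-th point of the sequence along
`β̃ₛ` starting at `c`. -/
def grPartial (c m : ℕ) : ℤ :=
  ∑ i ∈ Finset.range m, (if D.srcIsStartAt c i then (-1 : ℤ) else 1)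

/-- The `m`-th point of the sequence along `β̃ₛ` starting at `c` is a *turning point*:
its position on the line `y = 0` is either greater or smaller than the positions of
both its predecessor and its successor. -/
def TurningAt (c m : ℕ) : Prop :=
  1 ≤ m ∧ ((D.posAt c (m - 1) < D.posAt c m ∧ D.posAt c (m + 1) < D.posAt c m) ∨
    (D.posAt c m < D.posAt c (m - 1) ∧ D.posAt c m < D.posAt c (m + 1)))

/-- A *positive* turning point: its predecessor appears in its differential. -/
def PosTurningAt (c m : ℕ) : Prop := D.TurningAt c m ∧ ¬ D.srcIsStartAt c (m - 1)

/-- A *negative* turning point: it appears in the differential of its predecessor. -/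
def NegTurningAt (c m : ℕ) : Prop := D.TurningAt c m ∧ D.srcIsStartAt c (m - 1)

end StdDiagram

/-! ### Bifiltered complexes over 𝔽₂ -/

/-- A based, bifiltered, Maslov-graded complex over `𝔽₂ = ZMod 2`:  `d x y` is the
coefficient of the basis element `y` in the differential of the basis element `x`,
`gr` is the Maslov grading and `(fa, fb)` the `(i, j)`-bifiltration levels of the
basis elements. -/
structure BFC where
  ι : Type
  fin : Fintype ι
  dec : DecidableEq ι
  d : ι → ι → ZMod 2
  gr : ι → ℤ
  fa : ι → ℤ
  fb : ι → ℤ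

attribute [instance] BFC.fin BFC.dec

namespace BFC

/-- The dual of a bifiltered complex. -/
def dual (C : BFC) : BFC :=
  ⟨C.ι, C.fin, C.dec, fun u v => C.d v u, fun u => - C.gr u, fun u => - C.fa u,
    fun u => - C.fb u⟩

/-- The subcomplex (of a direct summand) spanned by the basis elements selected
by `S`. -/
def sub (C : BFC) (S : C.ι → Bool) : BFC where
  ι := {u : C.ι // S u = true}
  fin := Subtype.fintype _
  dec := Classical.decEq _
  d u v := C.d u.1 v.1
  gr u := C.gr u.1
  fa u := C.fa u.1
  fb u := C.fb u.1

/-- The number of basis elements in Maslov grading `g`. -/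
def grCount (C : BFC) (g : ℤ) : ℕ := (Finset.univ.filter fun u : C.ι => C.gr u = g).card

end BFC

/-- Definition 2.1: a positive staircase with `2N + 1` generators
`y₁, x₁, y₂, x₂, …, y_{N+1}` (even positions along the zigzag are the `y`'s, odd
positions the `x`'s), with `∂ xₗ = yₗ + y_{ℓ+1}`, `∂ yₗ = 0`, where consecutive
generators differ in only one of the two filtration coordinates, alternately. -/
def IsPosStaircaseOf (N : ℕ) (C : BFC) : Prop :=
  ∃ (e : Fin (2 * N + 1) ≃ C.ι) (f : Bool),
    (∀ k l : Fin (2 * N + 1), C.d (e k) (e l) =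
      if k.1 % 2 = 1 ∧ (k.1 = l.1 + 1 ∨ l.1 = k.1 + 1) then 1 else 0) ∧
    (∀ k l : Fin (2 * N + 1), l.1 = k.1 + 1 →
      (C.gr (e l) = C.gr (e k) + (if k.1 % 2 = 0 then 1 else -1)) ∧
      (if decide (k.1 % 2 = 0) = f then
        C.fb (e k) = C.fb (e l) ∧
          (if k.1 % 2 = 0 then C.fa (e k) < C.fa (e l) else C.fa (e l) < C.fa (e k))
      else
        C.fa (e k) = C.fa (e l) ∧
          (if k.1 % 2 = 0 then C.fb (e k) < C.fb (e l) else C.fb (e l) < C.fb (e k))))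

/-- A positive staircase (of any length). -/
def IsPosStaircase (C : BFC) : Prop := ∃ N : ℕ, IsPosStaircaseOf N C

/-- A negative staircase is the dual of a positive staircase. -/
def IsNegStaircase (C : BFC) : Prop := IsPosStaircase C.dual

/-- A staircase: a positive or a negative staircase. -/
def IsStaircase (C : BFC) : Prop := IsPosStaircase C ∨ IsNegStaircase C

/-- A staircase of given sign (`true` = positive). -/
def IsSignedStaircase (b : Bool) (C : BFC) : Prop :=
  if b then IsPosStaircase C else IsNegStaircase C

/-- A box of length 1: generators `a, b, c, d` at bifiltration levels
`(0,0), (0,1), (1,0), (1,1)` (up to an overall shift), with `∂d = b + c`,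
`∂b = ∂c = a`, `∂a = 0`. -/
def IsBox (C : BFC) : Prop :=
  ∃ (e : Fin 4 ≃ C.ι) (a0 b0 g0 : ℤ),
    C.fa (e 0) = a0 ∧ C.fb (e 0) = b0 ∧ C.gr (e 0) = g0 ∧
    C.fa (e 1) = a0 ∧ C.fb (e 1) = b0 + 1 ∧ C.gr (e 1) = g0 + 1 ∧
    C.fa (e 2) = a0 + 1 ∧ C.fb (e 2) = b0 ∧ C.gr (e 2) = g0 + 1 ∧
    C.fa (e 3) = a0 + 1 ∧ C.fb (e 3) = b0 + 1 ∧ C.gr (e 3) = g0 + 2 ∧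
    (∀ k l : Fin 4, C.d (e k) (e l) =
      if (k = 3 ∧ (l = 1 ∨ l = 2)) ∨ ((k = 1 ∨ k = 2) ∧ l = 0) then 1 else 0)

/-- `C` is the direct sum of a complex satisfying `P1` and one satisfying `P2`. -/
def IsDirectSumOf (C : BFC) (P1 P2 : BFC → Prop) : Prop :=
  ∃ S : C.ι → Bool, (∀ u v : C.ι, S u ≠ S v → C.d u v = 0) ∧
    P1 (C.sub S) ∧ P2 (C.sub fun u => ! S u)

/-- Definition 2.3 (a): a positive almost staircase of type (a), with generators
`x₁, …, x_{2k}`, `y₁, …, y_{2k+1}`, `y'_{k+1}` and `z`. -/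
def IsPosAlmostStairA (C : BFC) : Prop :=
  ∃ k : ℕ, 1 ≤ k ∧ ∃ (X Y : ℕ → C.ι) (y' z : C.ι) (a0 b0 : ℤ),
    Fintype.card C.ι = 4 * k + 3 ∧
    (∀ u : C.ι, u = y' ∨ u = z ∨ (∃ ℓ, 1 ≤ ℓ ∧ ℓ ≤ 2 * k ∧ u = X ℓ) ∨
      (∃ ℓ, 1 ≤ ℓ ∧ ℓ ≤ 2 * k + 1 ∧ u = Y ℓ)) ∧
    (∀ u v : C.ι, C.d u v ≠ 0 → C.gr u = C.gr v + 1) ∧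
    C.fa (Y (k + 1)) = a0 ∧ C.fb (Y (k + 1)) = b0 + 1 ∧
    C.fa y' = a0 + 1 ∧ C.fb y' = b0 ∧ C.fa z = a0 ∧ C.fb z = b0 ∧
    (∀ ℓ, 1 ≤ ℓ → ℓ ≤ 2 * k → C.fb (X ℓ) = C.fb (Y ℓ) ∧ C.fa (Y ℓ) < C.fa (X ℓ)) ∧
    (∀ ℓ, 1 ≤ ℓ → ℓ ≤ 2 * k → ℓ ≠ k →
      C.fa (X ℓ) = C.fa (Y (ℓ + 1)) ∧ C.fb (Y (ℓ + 1)) < C.fb (X ℓ)) ∧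
    (C.fa (X k) = C.fa y' ∧ C.fb y' < C.fb (X k)) ∧
    (∀ ℓ, 1 ≤ ℓ → ℓ ≤ 2 * k → ℓ ≠ k → ℓ ≠ k + 1 →
      ∀ v, C.d (X ℓ) v = if v = Y ℓ ∨ v = Y (ℓ + 1) then 1 else 0) ∧
    (∀ v, C.d (X k) v = if v = Y k ∨ v = Y (k + 1) ∨ v = y' then 1 else 0) ∧
    (∀ v, C.d (X (k + 1)) v = if v = Y (k + 1) ∨ v = Y (k + 2) ∨ v = y' then 1 else 0) ∧
    (∀ v, C.d (Y (k + 1)) v = if v = z then 1 else 0) ∧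
    (∀ v, C.d y' v = if v = z then 1 else 0) ∧
    (∀ ℓ, 1 ≤ ℓ → ℓ ≤ 2 * k + 1 → ℓ ≠ k + 1 → ∀ v, C.d (Y ℓ) v = 0) ∧
    (∀ v, C.d z v = 0)

/-- Definition 2.3 (b): a positive almost staircase of type (b), with generators
`x₁, …, x_{2k+1}`, `x'_{k+1}`, `y₁, …, y_{2k+2}` and `z`. -/
def IsPosAlmostStairB (C : BFC) : Prop :=
  ∃ k : ℕ, 1 ≤ k ∧ ∃ (X Y : ℕ → C.ι) (x' z : C.ι) (a0 b0 : ℤ),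
    Fintype.card C.ι = 4 * k + 5 ∧
    (∀ u : C.ι, u = x' ∨ u = z ∨ (∃ ℓ, 1 ≤ ℓ ∧ ℓ ≤ 2 * k + 1 ∧ u = X ℓ) ∨
      (∃ ℓ, 1 ≤ ℓ ∧ ℓ ≤ 2 * k + 2 ∧ u = Y ℓ)) ∧
    (∀ u v : C.ι, C.d u v ≠ 0 → C.gr u = C.gr v + 1) ∧
    C.fa (X (k + 1)) = a0 ∧ C.fb (X (k + 1)) = b0 - 1 ∧
    C.fa x' = a0 - 1 ∧ C.fb x' = b0 ∧ C.fa z = a0 ∧ C.fb z = b0 ∧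
    (∀ ℓ, 1 ≤ ℓ → ℓ ≤ 2 * k + 1 → C.fb (X ℓ) = C.fb (Y ℓ) ∧ C.fa (Y ℓ) < C.fa (X ℓ)) ∧
    (∀ ℓ, 1 ≤ ℓ → ℓ ≤ 2 * k + 1 → ℓ ≠ k + 1 →
      C.fa (X ℓ) = C.fa (Y (ℓ + 1)) ∧ C.fb (Y (ℓ + 1)) < C.fb (X ℓ)) ∧
    (C.fa x' = C.fa (Y (k + 2)) ∧ C.fb (Y (k + 2)) < C.fb x') ∧
    (∀ ℓ, 1 ≤ ℓ → ℓ ≤ 2 * k + 1 → ℓ ≠ k + 1 →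
      ∀ v, C.d (X ℓ) v = if v = Y ℓ ∨ v = Y (ℓ + 1) then 1 else 0) ∧
    (∀ v, C.d z v = if v = X (k + 1) ∨ v = x' then 1 else 0) ∧
    (∀ v, C.d (X (k + 1)) v = if v = Y (k + 1) ∨ v = Y (k + 2) then 1 else 0) ∧
    (∀ v, C.d x' v = if v = Y (k + 1) ∨ v = Y (k + 2) then 1 else 0) ∧
    (∀ ℓ, 1 ≤ ℓ → ℓ ≤ 2 * k + 2 → ∀ v, C.d (Y ℓ) v = 0)

/-- A positive almost staircase. -/
def IsPosAlmostStaircase (C : BFC) : Prop := IsPosAlmostStairA C ∨ IsPosAlmostStairB C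

/-- A negative almost staircase is the dual of a positive almost staircase. -/
def IsNegAlmostStaircase (C : BFC) : Prop := IsPosAlmostStaircase C.dual

/-- `C'` is obtained from `C` by a filtered change of basis: each basis element is
replaced by itself plus a sum of basis elements of the same Maslov grading and of
bifiltration level not higher in either coordinate. -/
def FilteredBasisChange (C C' : BFC) : Prop :=
  ∃ e : C'.ι ≃ C.ι,
    (∀ u, C'.gr u = C.gr (e u)) ∧ (∀ u, C'.fa u = C.fa (e u)) ∧
    (∀ u, C'.fb u = C.fb (e u)) ∧
    ∃ P Q : Matrix C.ι C.ι (ZMod 2),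
      P * Q = 1 ∧ Q * P = 1 ∧ (∀ u, P u u = 1) ∧
      (∀ u v, u ≠ v → P u v ≠ 0 → C.gr u = C.gr v ∧ C.fa v ≤ C.fa u ∧ C.fb v ≤ C.fb u) ∧
      (∀ u v, C'.d u v = (P * Matrix.of C.d * Q) (e u) (e v))

/-- `C` satisfies `P` after some filtered change of basis. -/
def AfterFCB (C : BFC) (P : BFC → Prop) : Prop := ∃ C', FilteredBasisChange C C' ∧ P C'

/-- The knot Floer chain complex `CFK(H, s)` of the standard diagram, in the spin^c
class of the intersection point `c`: it is generated by the intersection points of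
the class of `c`; the coefficient `⟨∂x, y⟩` counts (mod 2) the embedded bigons in
the universal cover cobounded by `α̃` and `β̃ₛ` from a lift of `x` to a lift of `y`;
the relative Maslov grading drops by `1` along each differential, and the relative
`(i, j)`-bifiltration drops according to the number of lifts of the basepoints `w`
and `z` covered by each bigon. -/
def CFK (D : StdDiagram) (c : ℕ) : BFC where
  ι := {a : Fin D.p // D.SameClass a c}
  fin := Subtype.fintype _
  dec := Classical.decEq _
  d x y := (D.arrowCnt x.1 y.1 : ZMod 2)
  gr x := D.grOf c x.1
  fa x := D.faOf c x.1
  fb x := D.fbOf c x.1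


namespace BFC

lemma exists_d_ne_zero_of_connected (C : BFC)
    (hgr : ∀ u v : C.ι, C.d u v ≠ 0 → C.gr u = C.gr v + 1)
    (hconn : ∀ u v : C.ι,
      Relation.ReflTransGen (fun a b => C.d a b ≠ 0 ∨ C.d b a ≠ 0) u v)
    (t : ℤ) (u v : C.ι) (hu : t ≤ C.gr u) (hv : C.gr v < t) :
    ∃ a b : C.ι, C.d a b ≠ 0 ∧ C.gr a = t := by
  by_contra! h
  have key : ∀ w, Relation.ReflTransGen (fun a b => C.d a b ≠ 0 ∨ C.d b a ≠ 0) u w →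
      t ≤ C.gr w := by
    intro w hw
    induction hw with
    | refl => exact hu
    | @tail b c _ hbc ih =>
      rcases hbc with hbc | hbc
      · have h1 := hgr _ _ hbc
        have h2 := h _ _ hbc
        omega
      · have h1 := hgr _ _ hbc
        omega
  have := key v (hconn u v)
  omega

lemma exists_gr_eq_of_grCount_ne_zero {C : BFC} {g : ℤ} (h : C.grCount g ≠ 0) :
    ∃ u, C.gr u = g := by
  obtain ⟨u, hu⟩ := Finset.card_ne_zero.mp h
  exact ⟨u, (Finset.mem_filter.mp hu).2⟩

lemma one_le_grCount (C : BFC) (u : C.ι) : 1 ≤ C.grCount (C.gr u) :=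
  Finset.card_pos.mpr ⟨u, by simp⟩

lemma grCount_eq_zero {C : BFC} {g : ℤ} (h : ∀ u, C.gr u ≠ g) : C.grCount g = 0 := by
  simpa [grCount, Finset.filter_eq_empty_iff] using h

lemma grCount_eq_one {C : BFC} {g : ℤ} (z : C.ι) (h : ∀ u, C.gr u = g ↔ u = z) :
    C.grCount g = 1 :=
  Finset.card_eq_one.mpr ⟨z, by ext u; simp [h]⟩

lemma grCount_sub (C : BFC) (S : C.ι → Bool) (g : ℤ) :
    (C.sub S).grCount g = (Finset.univ.filter fun u : C.ι => C.gr u = g ∧ S u = true).card := by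
  refine Finset.card_bij (fun u _ => u.1) ?_ ?_ ?_
  · intro a ha
    exact Finset.mem_filter.mpr ⟨Finset.mem_univ _, (Finset.mem_filter.mp ha).2, a.2⟩
  · intro a _ b _ h
    exact Subtype.ext h
  · intro b hb
    have hb' := (Finset.mem_filter.mp hb).2
    exact ⟨⟨b, hb'.2⟩, Finset.mem_filter.mpr ⟨Finset.mem_univ _, hb'.1⟩, rfl⟩

lemma grCount_eq_add (C : BFC) (S : C.ι → Bool) (g : ℤ) :
    C.grCount g = (C.sub S).grCount g + (C.sub fun u => ! S u).grCount g := by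
  rw [grCount_sub, grCount_sub, grCount,
    ← Finset.card_filter_add_card_filter_not (fun u => S u = true),
    Finset.filter_filter, Finset.filter_filter]
  simp

end BFC

/-- Whenever a grading `t` separates two generators, some generator of grading `t` has
nonzero differential.  Unlike connectedness of the graph of generators, this is invariant
under filtered changes of basis. -/
def NoGradingGap (C : BFC) : Prop :=
  ∀ (t : ℤ) (u v : C.ι), t ≤ C.gr u → C.gr v < t → ∃ a b, C.d a b ≠ 0 ∧ C.gr a = t

namespace FilteredBasisChange

variable {C C' : BFC}

lemma grCount_eq (h : FilteredBasisChange C C') (g : ℤ) : C'.grCount g = C.grCount g := by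
  obtain ⟨e, he, -⟩ := h
  exact Finset.card_equiv e (by simp [he])

lemma noGradingGap (h : FilteredBasisChange C C') (hC : NoGradingGap C) :
    NoGradingGap C' := by
  obtain ⟨e, he, -, -, P, Q, hPQ, hQP, -, hP, hd⟩ := h
  intro t u v hu hv
  obtain ⟨a, b, hab, hat⟩ := hC t (e u) (e v) (by rw [← he]; exact hu) (by rw [← he]; exact hv)
  by_contra! hno
  let G : Matrix C.ι C.ι (ZMod 2) := Matrix.diagonal fun w => if C.gr w = t then 1 else 0
  have hPG : P * G = G * P := by
    ext i j
    simp only [G, Matrix.mul_diagonal, Matrix.diagonal_mul]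
    by_cases hij : i = j
    · subst hij; ring
    by_cases hPij : P i j = 0
    · simp [hPij]
    · rw [(hP i j hij hPij).1]; ring
  have hQG : G * Q = Q * G := by
    calc G * Q = Q * P * (G * Q) := by rw [hQP, one_mul]
      _ = Q * (P * G) * Q := by simp only [Matrix.mul_assoc]
      _ = Q * G * (P * Q) := by rw [hPG]; simp only [Matrix.mul_assoc]
      _ = Q * G := by rw [hPQ, mul_one]
  have hzero : G * (P * Matrix.of C.d * Q) = 0 := by
    ext i j
    simp only [G, Matrix.diagonal_mul, Matrix.zero_apply]
    by_cases hi : C.gr i = t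
    · have h1 := hd (e.symm i) (e.symm j)
      simp only [Equiv.apply_symm_apply] at h1
      rw [← h1]
      have h2 : C'.d (e.symm i) (e.symm j) = 0 := by
        by_contra h3
        exact hno _ _ h3 (by rw [he]; simpa using hi)
      rw [h2, mul_zero]
    · simp [hi]
  have hGd : G * Matrix.of C.d = 0 := by
    calc G * Matrix.of C.d = G * (Q * P) * Matrix.of C.d * (Q * P) := by
          rw [hQP, mul_one, mul_one]
      _ = G * Q * (P * Matrix.of C.d * Q) * P := by simp only [Matrix.mul_assoc]
      _ = Q * (G * (P * Matrix.of C.d * Q)) * P := by rw [hQG]; simp only [Matrix.mul_assoc]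
      _ = 0 := by rw [hzero, mul_zero, zero_mul]
  apply hab
  have := congrFun (congrFun hGd a) b
  simpa [G, Matrix.diagonal_mul, hat] using this

end FilteredBasisChange

lemma IsPosStaircase.exists_grading {C : BFC} (h : IsPosStaircase C) :
    ∃ m : ℤ, (∃ u, C.gr u = m) ∧ (∀ u, C.gr u = m ∨ C.gr u = m + 1) ∧
      ∀ u v, C.d u v ≠ 0 → C.gr u = m + 1 ∧ C.gr v = m := by
  obtain ⟨N, e, f, hd, hgr⟩ := h
  have hall : ∀ (k : ℕ) (hk : k < 2 * N + 1),
      C.gr (e ⟨k, hk⟩) = C.gr (e ⟨0, by omega⟩) + ((k % 2 : ℕ) : ℤ) := by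
    intro k
    induction k with
    | zero => intro hk; simp
    | succ k ih =>
      intro hk
      rw [(hgr ⟨k, by omega⟩ ⟨k + 1, hk⟩ rfl).1, ih]
      split_ifs with h <;> simp only at h <;> omega
  refine ⟨C.gr (e ⟨0, by omega⟩), ⟨_, rfl⟩, ?_, ?_⟩
  · intro u
    obtain ⟨k, rfl⟩ := e.surjective u
    rw [hall k.1 k.2]
    omega
  · intro u v huv
    obtain ⟨k, rfl⟩ := e.surjective u
    obtain ⟨l, rfl⟩ := e.surjective v
    rw [hd] at huv
    have hkl : k.1 % 2 = 1 ∧ (k.1 = l.1 + 1 ∨ l.1 = k.1 + 1) := by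
      by_contra hc
      exact huv (if_neg hc)
    rw [hall k.1 k.2, hall l.1 l.2]
    omega

lemma IsBox.exists_grCount {C : BFC} (h : IsBox C) :
    ∃ g : ℤ, C.grCount g = 1 ∧ C.grCount (g + 1) = 2 ∧ C.grCount (g + 2) = 1 ∧
      (∀ t, t ≠ g → t ≠ g + 1 → t ≠ g + 2 → C.grCount t = 0) ∧
      ∀ u v, C.d u v ≠ 0 → C.gr u ≠ g := by
  obtain ⟨e, a0, b0, g, -, -, h0, -, -, h1, -, -, h2, -, -, h3, hd⟩ := h
  have hcount : ∀ t, C.grCount t = (if g = t then 1 else 0) + (if g + 1 = t then 1 else 0) +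
      (if g + 1 = t then 1 else 0) + (if g + 2 = t then 1 else 0) := by
    intro t
    rw [BFC.grCount, Finset.card_filter, ← Equiv.sum_comp e, Fin.sum_univ_four, h0, h1, h2, h3]
  refine ⟨g, ?_, ?_, ?_, ?_, ?_⟩
  · rw [hcount]; simp
  · rw [hcount]; simp
  · rw [hcount]; simp
  · intro t ht0 ht1 ht2
    rw [hcount]; simp [ht0.symm, ht1.symm, ht2.symm]
  · intro u v huv hu
    obtain ⟨k, rfl⟩ := e.surjective u
    obtain ⟨l, rfl⟩ := e.surjective v
    have hk : k = 0 := by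
      fin_cases k <;> simp_all
    subst hk
    exact huv (by simp [hd])

/-- The admissible patterns for the numbers of generators in each grading. -/
def HasGradingPattern (c : ℤ → ℕ) : Prop :=
  ∃ g0 : ℤ,
    (c g0 = 1 ∧ 1 ≤ c (g0 - 1) ∧ 1 ≤ c (g0 - 2) ∧
      ∀ g, g ≠ g0 → g ≠ g0 - 1 → g ≠ g0 - 2 → c g = 0) ∨
    (1 ≤ c g0 ∧ 1 ≤ c (g0 - 1) ∧ c (g0 - 2) = 1 ∧
      ∀ g, g ≠ g0 → g ≠ g0 - 1 → g ≠ g0 - 2 → c g = 0) ∨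
    (c g0 = 1 ∧ c (g0 - 1) = 2 ∧ 1 ≤ c (g0 - 2) ∧ 1 ≤ c (g0 - 3) ∧
      ∀ g, g ≠ g0 → g ≠ g0 - 1 → g ≠ g0 - 2 → g ≠ g0 - 3 → c g = 0) ∨
    (1 ≤ c g0 ∧ 1 ≤ c (g0 - 1) ∧ c (g0 - 2) = 2 ∧ c (g0 - 3) = 1 ∧
      ∀ g, g ≠ g0 → g ≠ g0 - 1 → g ≠ g0 - 2 → g ≠ g0 - 3 → c g = 0)

/-- The pattern of a sum of a function concentrated at `m` and `m + 1` and of the grading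
counts of a box with lowest grading `g`. -/
lemma hasGradingPattern_add {s b : ℤ → ℕ} {m g : ℤ} (hm : g - 1 ≤ m) (hm' : m ≤ g + 2)
    (hs : 1 ≤ s m) (hs0 : ∀ t, t ≠ m → t ≠ m + 1 → s t = 0)
    (hb : b g = 1) (hb1 : b (g + 1) = 2) (hb2 : b (g + 2) = 1)
    (hb0 : ∀ t, t ≠ g → t ≠ g + 1 → t ≠ g + 2 → b t = 0) :
    HasGradingPattern fun t => s t + b t := by
  obtain rfl | rfl | rfl | rfl : m = g - 1 ∨ m = g ∨ m = g + 1 ∨ m = g + 2 := by omega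
  · refine ⟨g + 2, Or.inr (Or.inr (Or.inl ?_))⟩
    have e1 : g + 2 - 1 = g + 1 := by ring
    have e2 : g + 2 - 2 = g := by ring
    have e3 : g + 2 - 3 = g - 1 := by ring
    simp only [e1, e2, e3]
    have := hs0 (g + 2) (by omega) (by omega)
    have := hs0 (g + 1) (by omega) (by omega)
    refine ⟨by omega, by omega, by omega, by omega, fun t h1 h2 h3 h4 => ?_⟩
    rw [hs0 t (by omega) (by omega), hb0 t (by omega) (by omega) (by omega)]
  · refine ⟨m + 2, Or.inl ?_⟩
    have e1 : m + 2 - 1 = m + 1 := by ring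
    have e2 : m + 2 - 2 = m := by ring
    simp only [e1, e2]
    have := hs0 (m + 2) (by omega) (by omega)
    refine ⟨by omega, by omega, by omega, fun t h1 h2 h3 => ?_⟩
    rw [hs0 t (by omega) (by omega), hb0 t (by omega) (by omega) (by omega)]
  · refine ⟨g + 2, Or.inr (Or.inl ?_)⟩
    have e1 : g + 2 - 1 = g + 1 := by ring
    have e2 : g + 2 - 2 = g := by ring
    simp only [e1, e2]
    have := hs0 g (by omega) (by omega)
    refine ⟨by omega, by omega, by omega, fun t h1 h2 h3 => ?_⟩
    rw [hs0 t (by omega) (by omega), hb0 t (by omega) (by omega) (by omega)]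
  · have h0 := hs0 g (by omega) (by omega)
    have h1 := hs0 (g + 1) (by omega) (by omega)
    have e3 : g + 2 + 1 = g + 3 := by ring
    rw [e3] at hs0
    by_cases hn : s (g + 3) = 0
    · refine ⟨g + 2, Or.inr (Or.inl ?_)⟩
      have e1 : g + 2 - 1 = g + 1 := by ring
      have e2 : g + 2 - 2 = g := by ring
      simp only [e1, e2]
      refine ⟨by omega, by omega, by omega, fun t h1 h2 h3 => ?_⟩
      rw [hb0 t (by omega) (by omega) (by omega)]
      by_cases ht : t = g + 3
      · rw [ht, hn]
      · rw [hs0 t (by omega) (by omega)]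
    · refine ⟨g + 3, Or.inr (Or.inr (Or.inr ?_))⟩
      have e1 : g + 3 - 1 = g + 2 := by ring
      have e2 : g + 3 - 2 = g + 1 := by ring
      have e3 : g + 3 - 3 = g := by ring
      simp only [e1, e2, e3]
      refine ⟨by omega, by omega, by omega, by omega, fun t h1 h2 h3 h4 => ?_⟩
      rw [hs0 t (by omega) (by omega), hb0 t (by omega) (by omega) (by omega)]

lemma IsDirectSumOf.hasGradingPattern {C : BFC}
    (h : IsDirectSumOf C IsPosStaircase IsBox) (hC : NoGradingGap C) :
    HasGradingPattern C.grCount := by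
  obtain ⟨S, hS, hstair, hbox⟩ := h
  obtain ⟨m, ⟨y, hy⟩, hm, hmd⟩ := hstair.exists_grading
  obtain ⟨g, hb, hb1, hb2, hb0, hbd⟩ := hbox.exists_grCount
  obtain ⟨a, ha⟩ := BFC.exists_gr_eq_of_grCount_ne_zero (hb.trans_ne one_ne_zero)
  have hnotbox : ∀ u, C.gr u ≠ g → C.gr u ≠ g + 1 → C.gr u ≠ g + 2 → S u = true := by
    intro u h0 h1 h2
    by_contra hu
    have := (C.sub fun u => ! S u).one_le_grCount ⟨u, by simpa using hu⟩
    exact absurd (hb0 _ h0 h1 h2) (Nat.one_le_iff_ne_zero.mp this)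
  have harrow : ∀ u v, C.d u v ≠ 0 → S u = true → C.gr u = m + 1 ∧ C.gr v = m := by
    intro u v huv hu
    have hSuv : S u = S v := by
      by_contra hne
      exact huv (hS u v hne)
    exact hmd ⟨u, hu⟩ ⟨v, hSuv ▸ hu⟩ huv
  have hsplit : C.grCount = fun t => (C.sub S).grCount t + (C.sub fun u => ! S u).grCount t :=
    funext fun t => C.grCount_eq_add S t
  have hy' : C.gr y.1 = m := hy
  have ha' : C.gr a.1 = g := ha
  rw [hsplit]
  refine hasGradingPattern_add (m := m) (g := g) ?_ ?_ (hy ▸ BFC.one_le_grCount _ y) ?_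
    hb hb1 hb2 hb0
  · by_contra! hlt
    obtain ⟨u, v, huv, hu⟩ := hC g a.1 y.1 (by omega) (by omega)
    by_cases hSu : S u = true
    · have := harrow u v huv hSu
      omega
    · have hSv : S v ≠ true := by
        intro hSv
        exact huv (hS u v fun h => hSu (h.trans hSv))
      exact hbd ⟨u, by simpa using hSu⟩ ⟨v, by simpa using hSv⟩ huv hu
  · by_contra! hlt
    obtain ⟨u, v, huv, hu⟩ := hC (g + 3) y.1 a.1 (by omega) (by omega)
    have := harrow u v huv (hnotbox u (by omega) (by omega) (by omega))
    omega
  · intro t h0 h1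
    refine BFC.grCount_eq_zero fun u hu => ?_
    rcases hm u with h | h <;> omega

/-- Generators linked in a zigzag by elements covering consecutive ones all have the same
grading. -/
lemma gr_zigzag {C : BFC} (hgr : ∀ u v : C.ι, C.d u v ≠ 0 → C.gr u = C.gr v + 1)
    {X Y : ℕ → C.ι} {n : ℕ}
    (hX : ∀ ℓ, 1 ≤ ℓ → ℓ ≤ n → C.d (X ℓ) (Y ℓ) ≠ 0 ∧ C.d (X ℓ) (Y (ℓ + 1)) ≠ 0) :
    (∀ ℓ, 1 ≤ ℓ → ℓ ≤ n + 1 → C.gr (Y ℓ) = C.gr (Y 1)) ∧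
      ∀ ℓ, 1 ≤ ℓ → ℓ ≤ n → C.gr (X ℓ) = C.gr (Y 1) + 1 := by
  have hY : ∀ ℓ, 1 ≤ ℓ → ℓ ≤ n + 1 → C.gr (Y ℓ) = C.gr (Y 1) := by
    intro ℓ h1
    induction ℓ, h1 using Nat.le_induction with
    | base => simp
    | succ k hk ih =>
      intro hkn
      have h := hX k hk (by omega)
      have := hgr _ _ h.1
      have := hgr _ _ h.2
      have := ih (by omega)
      omega
  refine ⟨hY, fun ℓ h1 hn => ?_⟩
  rw [hgr _ _ (hX ℓ h1 hn).1, hY ℓ h1 (by omega)]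

lemma IsPosAlmostStairA.hasGradingPattern {C : BFC} (h : IsPosAlmostStairA C) :
    HasGradingPattern C.grCount := by
  obtain ⟨k, hk, X, Y, y', z, a0, b0, -, hcov, hgr, -, -, -, -, -, -, -, -, -,
    hX, hXk, hXk1, hYk, hy', -, -⟩ := h
  obtain ⟨hYgr, hXgr⟩ := gr_zigzag (X := X) (Y := Y) (n := 2 * k) hgr (by
    intro ℓ h1 h2
    by_cases hlk : ℓ = k
    · subst hlk; simp [hXk]
    by_cases hlk1 : ℓ = k + 1
    · subst hlk1; simp [hXk1]
    · simp [hX ℓ h1 h2 hlk hlk1])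
  have hz : C.gr (Y (k + 1)) = C.gr z + 1 := hgr _ _ (by simp [hYk])
  have hzy : C.gr y' = C.gr z + 1 := hgr _ _ (by simp [hy'])
  have hYk1 := hYgr (k + 1) (by omega) (by omega)
  have hX1 := hXgr 1 le_rfl (by omega)
  have hall : ∀ u, u = z ∨ C.gr u = C.gr z + 1 ∨ C.gr u = C.gr z + 2 := by
    intro u
    rcases hcov u with rfl | rfl | ⟨ℓ, h1, h2, rfl⟩ | ⟨ℓ, h1, h2, rfl⟩
    · exact Or.inr (Or.inl hzy)
    · exact Or.inl rfl
    · have := hXgr ℓ h1 h2; omega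
    · have := hYgr ℓ h1 h2; omega
  refine ⟨C.gr z + 2, Or.inr (Or.inl ⟨?_, ?_, ?_, ?_⟩)⟩
  · rw [show C.gr z + 2 = C.gr (X 1) by omega]; exact C.one_le_grCount _
  · rw [show C.gr z + 2 - 1 = C.gr y' by omega]; exact C.one_le_grCount _
  · refine BFC.grCount_eq_one z fun u => ⟨fun hu => ?_, ?_⟩
    · rcases hall u with h | h | h
      · exact h
      all_goals omega
    · rintro rfl; ring
  · intro t h0 h1 h2
    refine BFC.grCount_eq_zero fun u hu => ?_
    rcases hall u with rfl | h | h <;> omega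

lemma IsPosAlmostStairB.hasGradingPattern {C : BFC} (h : IsPosAlmostStairB C) :
    HasGradingPattern C.grCount := by
  obtain ⟨k, hk, X, Y, x', z, a0, b0, -, hcov, hgr, -, -, -, -, -, -, -, -, -,
    hX, hz, hXk1, hx', -⟩ := h
  obtain ⟨hYgr, hXgr⟩ := gr_zigzag (X := X) (Y := Y) (n := 2 * k + 1) hgr (by
    intro ℓ h1 h2
    by_cases hlk1 : ℓ = k + 1
    · subst hlk1; simp [hXk1]
    · simp [hX ℓ h1 h2 hlk1])
  have hzX : C.gr z = C.gr (X (k + 1)) + 1 := hgr _ _ (by simp [hz])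
  have hzx' : C.gr z = C.gr x' + 1 := hgr _ _ (by simp [hz])
  have hXk := hXgr (k + 1) (by omega) (by omega)
  have hall : ∀ u, u = z ∨ C.gr u = C.gr z - 1 ∨ C.gr u = C.gr z - 2 := by
    intro u
    rcases hcov u with rfl | rfl | ⟨ℓ, h1, h2, rfl⟩ | ⟨ℓ, h1, h2, rfl⟩
    · omega
    · exact Or.inl rfl
    · have := hXgr ℓ h1 h2; omega
    · have := hYgr ℓ h1 h2; omega
  refine ⟨C.gr z, Or.inl ⟨?_, ?_, ?_, ?_⟩⟩
  · refine BFC.grCount_eq_one z fun u => ⟨fun hu => ?_, fun hu => hu ▸ rfl⟩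
    rcases hall u with h | h | h
    · exact h
    all_goals omega
  · rw [show C.gr z - 1 = C.gr x' by omega]; exact C.one_le_grCount _
  · rw [show C.gr z - 2 = C.gr (Y 1) by omega]; exact C.one_le_grCount _
  · intro t h0 h1 h2
    refine BFC.grCount_eq_zero fun u hu => ?_
    rcases hall u with rfl | h | h <;> omega

/-- Lemma 3.4, algebraic form.  Let `C` be a finitely generated
bifiltered chain complex over `𝔽₂` with a `ℤ`-valued Maslov grading for which the
differential is homogeneous of degree `-1`, whose basis consists of homogeneous
elements and is connected under differentials, and suppose some filtered change of
basis carries the basis to the standard generators of either the direct sum of a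
positive staircase and a box of length 1, or a positive almost staircase.  Then the
basis elements lie in either `3` or `4` consecutive Maslov gradings, with
multiplicities (from highest to lowest) of one of the forms `(1,*,*)`, `(*,*,1)`,
`(1,2,*,*)`, `(*,*,2,1)`, where each `*` is a positive integer. -/
theorem grading_multiplicity_pattern (C : BFC)
    (hd2 : ∀ u w : C.ι, (∑ v : C.ι, C.d u v * C.d v w) = 0)
    (hgr : ∀ u v : C.ι, C.d u v ≠ 0 → C.gr u = C.gr v + 1)
    (hfil : ∀ u v : C.ι, C.d u v ≠ 0 → C.fa v ≤ C.fa u ∧ C.fb v ≤ C.fb u)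
    (hconn : ∀ u v : C.ι,
      Relation.ReflTransGen (fun a b => C.d a b ≠ 0 ∨ C.d b a ≠ 0) u v)
    (hmodel : AfterFCB C fun C' =>
      IsDirectSumOf C' IsPosStaircase IsBox ∨ IsPosAlmostStaircase C') :
    ∃ g0 : ℤ,
      (C.grCount g0 = 1 ∧ 1 ≤ C.grCount (g0 - 1) ∧ 1 ≤ C.grCount (g0 - 2) ∧
        ∀ g, g ≠ g0 → g ≠ g0 - 1 → g ≠ g0 - 2 → C.grCount g = 0) ∨
      (1 ≤ C.grCount g0 ∧ 1 ≤ C.grCount (g0 - 1) ∧ C.grCount (g0 - 2) = 1 ∧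
        ∀ g, g ≠ g0 → g ≠ g0 - 1 → g ≠ g0 - 2 → C.grCount g = 0) ∨
      (C.grCount g0 = 1 ∧ C.grCount (g0 - 1) = 2 ∧ 1 ≤ C.grCount (g0 - 2) ∧
        1 ≤ C.grCount (g0 - 3) ∧
        ∀ g, g ≠ g0 → g ≠ g0 - 1 → g ≠ g0 - 2 → g ≠ g0 - 3 → C.grCount g = 0) ∨
      (1 ≤ C.grCount g0 ∧ 1 ≤ C.grCount (g0 - 1) ∧ C.grCount (g0 - 2) = 2 ∧
        C.grCount (g0 - 3) = 1 ∧
        ∀ g, g ≠ g0 → g ≠ g0 - 1 → g ≠ g0 - 2 → g ≠ g0 - 3 → C.grCount g = 0) := by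
  obtain ⟨C', hCC', hC'⟩ := hmodel
  have hgap : NoGradingGap C' :=
    hCC'.noGradingGap fun t u v => C.exists_d_ne_zero_of_connected hgr hconn t u v
  have hcount : C.grCount = C'.grCount := funext fun g => (hCC'.grCount_eq g).symm
  rw [hcount]
  rcases hC' with h | h | h
  · exact h.hasGradingPattern hgap
  · exact h.hasGradingPattern
  · exact h.hasGradingPattern

end

end OneOneKnot
end

section
/- Let H be a standard (1,1) diagram and s a class of intersection points. Suppose b and c are turning points of β̃_s that are consecutive along β̃_s (no turning point lies strictly between them), and label the points of α̃ ∩ β̃_s from b to c along β̃_s (inclusive) as x_0 = b, x_1, x_2, …. Then for every index ℓ: gr(x_ℓ) = gr(b) if ℓ is even; gr(x_ℓ) = gr(b) + 1 if ℓ is odd and b is a positive turning point; and gr(x_ℓ) = gr(b) − 1 if ℓ is odd and b is a negative turning point. (Lemma 3.6 of the paper.) -/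
/-!
Common combinatorial framework for standard (1,1) diagrams in Rasmussen standard
form, their lifts to the universal cover of the torus, and the combinatorial knot
Floer chain complexes they define.
-/

namespace OneOneKnot

open scoped Classical

noncomputable section

namespace StdDiagram

variable {D : StdDiagram}

/-- The same intersection point, traversed in the opposite direction. -/
def rev (σ : CState) : CState := ⟨σ.pos, !σ.up, σ.top, σ.ht⟩

/-- The deck translate of a state by `a` fundamental domains horizontally and `b`
vertically (in the sheared coordinate `pos`). -/
def translate (D : StdDiagram) (a b : ℤ) (σ : CState) : CState :=
  ⟨σ.pos + D.pz * a, σ.up, σ.top, σ.ht + b⟩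

/-- The representative of a state modulo deck translations. -/
def reduce (D : StdDiagram) (σ : CState) : CState := ⟨σ.pos % D.pz, σ.up, σ.top, 0⟩

@[ext] theorem cstate_ext {σ τ : CState} (h₁ : σ.pos = τ.pos) (h₂ : σ.up = τ.up)
    (h₃ : σ.top = τ.top) (h₄ : σ.ht = τ.ht) : σ = τ := by
  cases σ; cases τ; simp_all

theorem pz_pos : 0 < D.pz := by have := D.hp; unfold pz; omega

theorem two_mul_qz_add_rz_le : 2 * D.qz + D.rz ≤ D.pz := by
  have := D.h2qr; unfold pz qz rz; omega

theorem qz_nonneg : 0 ≤ D.qz := by unfold qz; omega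

theorem rz_nonneg : 0 ≤ D.rz := by unfold rz; omega

@[simp] theorem rev_rev (σ : CState) : rev (rev σ) = σ := by simp [rev]

theorem reduce_translate (a b : ℤ) (σ : CState) :
    D.reduce (D.translate a b σ) = D.reduce σ := by
  simp [translate, reduce]

theorem translate_injective (a b : ℤ) : Function.Injective (D.translate a b) := by
  intro σ τ h
  simp only [translate, CState.mk.injEq] at h
  ext
  · linarith [h.1]
  · exact h.2.1
  · exact h.2.2.1
  · linarith [h.2.2.2]

theorem reduce_eq_reduce_iff {σ τ : CState} :
    D.reduce σ = D.reduce τ ↔ ∃ a b, τ = D.translate a b σ := by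
  constructor
  · intro h
    refine ⟨τ.pos / D.pz - σ.pos / D.pz, τ.ht - σ.ht, ?_⟩
    simp only [reduce, CState.mk.injEq] at h
    have h₁ := Int.emod_add_mul_ediv σ.pos D.pz
    have h₂ := Int.emod_add_mul_ediv τ.pos D.pz
    ext
    · simp only [translate, mul_sub]; linarith [h.1]
    · exact h.2.1.symm
    · exact h.2.2.1.symm
    · simp [translate]
  · rintro ⟨a, b, rfl⟩
    exact (reduce_translate a b σ).symm

theorem reduce_rev (σ : CState) : D.reduce (rev σ) = rev (D.reduce σ) := rfl

theorem step_translate (a b : ℤ) (σ : CState) :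
    D.step (D.translate a b σ) = D.translate a b (D.step σ) := by
  obtain ⟨x, u, t, y⟩ := σ
  cases u <;> cases t <;> simp only [step, translate, Int.add_mul_emod_self_left] <;>
    split_ifs <;> simp_all <;> ring_nf <;> simp

theorem stepB_eq_rev_step_rev (σ : CState) : D.stepB σ = rev (D.step (rev σ)) := by
  obtain ⟨x, u, t, y⟩ := σ
  have hq := D.qz_nonneg
  cases u <;> cases t <;>
    simp only [step, stepB, rev, Bool.not_true, Bool.not_false, if_true, if_false,
      reduceCtorEq] <;>
    split_ifs <;> first | rfl | (exfalso; omega)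

theorem stepB_step (σ : CState) : D.stepB (D.step σ) = σ := by
  obtain ⟨x, u, t, y⟩ := σ
  have hp := D.pz_pos
  have hq := D.qz_nonneg
  have hr := D.rz_nonneg
  have hqr := D.two_mul_qz_add_rz_le
  have hm₀ := Int.emod_nonneg x hp.ne'
  have hm₁ := Int.emod_lt_of_pos x hp
  have hx := Int.emod_add_mul_ediv x D.pz
  have key : ∀ y k : ℤ, 0 ≤ k → k < D.pz → y = k + D.pz * (x / D.pz) → y % D.pz = k := by
    rintro y k h₀ h₁ rfl
    rw [Int.add_mul_emod_self_left, Int.emod_eq_of_lt h₀ h₁]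
  cases u <;> cases t
  · simp [step, stepB]
  · by_cases h₁ : x % D.pz ≤ D.rz - 1
    · have h := key (x + 2 * D.qz) (x % D.pz + 2 * D.qz) (by omega) (by omega) (by omega)
      simp only [step, stepB, h₁, h, if_true, if_false, reduceCtorEq]
      split_ifs <;> first | (exfalso; omega) | (ext <;> first | rfl | (dsimp only; omega))
    · by_cases h₂ : x % D.pz ≤ D.rz + 2 * D.qz - 1
      · have h := key (2 * D.rz + 2 * D.qz - 1 - 2 * (x % D.pz) + x)
          (2 * D.rz + 2 * D.qz - 1 - x % D.pz) (by omega) (by omega) (by omega)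
        simp only [step, stepB, h₁, h₂, h, if_true, if_false, reduceCtorEq]
        split_ifs <;> first | (exfalso; omega) | (ext <;> first | rfl | (dsimp only; omega))
      · simp only [step, stepB, h₁, h₂, if_true, if_false, reduceCtorEq]
        split_ifs <;> first | (exfalso; omega) | (ext <;> first | rfl | (dsimp only; omega))
  · by_cases h₁ : x % D.pz ≤ 2 * D.qz - 1
    · have h := key (2 * D.qz - 1 - 2 * (x % D.pz) + x)
          (2 * D.qz - 1 - x % D.pz) (by omega) (by omega) (by omega)
      simp only [step, stepB, h₁, h, if_true, if_false, reduceCtorEq]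
      split_ifs <;> first | (exfalso; omega) | (ext <;> first | rfl | (dsimp only; omega))
    · by_cases h₂ : x % D.pz ≤ D.rz + 2 * D.qz - 1
      · have h := key (x - 2 * D.qz) (x % D.pz - 2 * D.qz) (by omega) (by omega) (by omega)
        simp only [step, stepB, h₁, h₂, h, if_true, if_false, reduceCtorEq]
        split_ifs <;> first | (exfalso; omega) | (ext <;> first | rfl | (dsimp only; omega))
      · simp only [step, stepB, h₁, h₂, if_true, if_false, and_false, reduceCtorEq]
        split_ifs <;> first | (exfalso; omega) | (ext <;> first | rfl | (dsimp only; omega))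
  · simp [step, stepB]

theorem step_injective : Function.Injective D.step :=
  Function.LeftInverse.injective stepB_step

theorem step_stepB (σ : CState) : D.step (D.stepB σ) = σ := by
  have h := stepB_step (D := D) (rev σ)
  rw [stepB_eq_rev_step_rev] at h ⊢
  simpa using congrArg rev h

theorem stepB_translate (a b : ℤ) (σ : CState) :
    D.stepB (D.translate a b σ) = D.translate a b (D.stepB σ) := by
  apply step_injective (D := D)
  rw [step_stepB, step_translate, step_stepB]

theorem iterate_step_translate (a b : ℤ) (n : ℕ) (σ : CState) :
    D.step^[n] (D.translate a b σ) = D.translate a b (D.step^[n] σ) :=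
  (Function.Semiconj.iterate_right (f := D.translate a b)
    (fun σ => (step_translate a b σ).symm) n σ).symm

theorem reduce_step_congr {σ τ : CState} (h : D.reduce σ = D.reduce τ) :
    D.reduce (D.step σ) = D.reduce (D.step τ) := by
  obtain ⟨a, b, rfl⟩ := reduce_eq_reduce_iff.1 h
  rw [step_translate, reduce_translate]

theorem reduce_stepB_congr {σ τ : CState} (h : D.reduce σ = D.reduce τ) :
    D.reduce (D.stepB σ) = D.reduce (D.stepB τ) := by
  obtain ⟨a, b, rfl⟩ := reduce_eq_reduce_iff.1 h
  rw [stepB_translate, reduce_translate]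

theorem reduce_of_reduce_step {σ τ : CState} (h : D.reduce (D.step σ) = D.reduce (D.step τ)) :
    D.reduce σ = D.reduce τ := by
  simpa only [stepB_step] using reduce_stepB_congr h

theorem reduce_of_reduce_iterate_step {σ τ : CState} (n : ℕ)
    (h : D.reduce (D.step^[n] σ) = D.reduce (D.step^[n] τ)) : D.reduce σ = D.reduce τ := by
  induction n with
  | zero => exact h
  | succ n ih =>
    rw [Function.iterate_succ_apply', Function.iterate_succ_apply'] at h
    exact ih (reduce_of_reduce_step h)

theorem reduce_step_ne_reduce_rev (σ : CState) : D.reduce (D.step σ) ≠ D.reduce (rev σ) := by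
  obtain ⟨x, u, t, y⟩ := σ
  have hp := D.pz_pos
  have hq := D.qz_nonneg
  have hr := D.rz_nonneg
  have hqr := D.two_mul_qz_add_rz_le
  have hm₀ := Int.emod_nonneg x hp.ne'
  have hx := Int.emod_add_mul_ediv x D.pz
  have key : ∀ y k : ℤ, 0 ≤ k → k < D.pz → y = k + D.pz * (x / D.pz) → y % D.pz = k := by
    rintro y k h₀ h₁ rfl
    rw [Int.add_mul_emod_self_left, Int.emod_eq_of_lt h₀ h₁]
  cases u <;> cases t
  · simp [step, reduce, rev]
  · by_cases h₁ : x % D.pz ≤ D.rz - 1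
    · simp [step, reduce, rev, h₁]
    · by_cases h₂ : x % D.pz ≤ D.rz + 2 * D.qz - 1
      · have h := key (2 * D.rz + 2 * D.qz - 1 - 2 * (x % D.pz) + x)
          (2 * D.rz + 2 * D.qz - 1 - x % D.pz) (by omega) (by omega) (by omega)
        simp [step, reduce, rev, h₁, h₂, h]
        omega
      · simp [step, reduce, rev, h₁, h₂]
  · by_cases h₁ : x % D.pz ≤ 2 * D.qz - 1
    · have h := key (2 * D.qz - 1 - 2 * (x % D.pz) + x)
          (2 * D.qz - 1 - x % D.pz) (by omega) (by omega) (by omega)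
      simp [step, reduce, rev, h₁, h]
      omega
    · by_cases h₂ : x % D.pz ≤ D.rz + 2 * D.qz - 1 <;> simp [step, reduce, rev, h₁, h₂]
  · simp [step, reduce, rev]

/-- A curve never comes back to one of its points with the opposite direction. -/
theorem reduce_iterate_step_ne_reduce_rev (n : ℕ) (σ : CState) :
    D.reduce (D.step^[n] σ) ≠ D.reduce (rev σ) := by
  induction n using Nat.twoStepInduction generalizing σ with
  | zero => simp [reduce, rev]
  | one => exact reduce_step_ne_reduce_rev σ
  | more n ih _ =>
    intro h
    apply ih (D.step σ)
    have h' := reduce_stepB_congr h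
    rwa [Function.iterate_succ_apply', stepB_step, stepB_eq_rev_step_rev (rev σ), rev_rev,
      Function.iterate_succ_apply] at h'

/-- The state is a lift of a state of the reference traversal of `β`. -/
def OnBeta (D : StdDiagram) (σ : CState) : Prop :=
  ∃ n : ℕ, D.reduce σ = D.reduce (D.step^[n] start0)

theorem OnBeta.step {σ : CState} (h : D.OnBeta σ) : D.OnBeta (D.step σ) := by
  obtain ⟨n, hn⟩ := h
  exact ⟨n + 1, by rw [Function.iterate_succ_apply']; exact reduce_step_congr hn⟩

theorem exists_pos_reduce_iterate_start0 :
    ∃ n : ℕ, 0 < n ∧ D.reduce (D.step^[n] start0) = D.reduce start0 := by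
  let f : ℕ → Fin D.p × Bool × Bool := fun n =>
    (⟨((D.step^[n] start0).pos % D.pz).toNat, by
      have h₀ := Int.emod_nonneg (D.step^[n] start0).pos D.pz_pos.ne'
      have h₁ := Int.emod_lt_of_pos (D.step^[n] start0).pos D.pz_pos
      have h₂ : D.pz = D.p := rfl
      omega⟩, (D.step^[n] start0).up, (D.step^[n] start0).top)
  have key : ∀ i j, f i = f j → i < j → ∃ n : ℕ, 0 < n ∧
      D.reduce (D.step^[n] start0) = D.reduce start0 := by
    intro i j hij hlt
    refine ⟨j - i, by omega, reduce_of_reduce_iterate_step i ?_⟩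
    rw [← Function.iterate_add_apply, Nat.add_sub_cancel' hlt.le]
    simp only [f, Prod.mk.injEq, Fin.mk.injEq] at hij
    have h₀ := Int.emod_nonneg (D.step^[i] start0).pos D.pz_pos.ne'
    have h₁ := Int.emod_nonneg (D.step^[j] start0).pos D.pz_pos.ne'
    simp only [reduce, CState.mk.injEq]
    exact ⟨by omega, hij.2.1.symm, hij.2.2.symm, trivial⟩
  obtain ⟨i, j, hne, hij⟩ := Finite.exists_ne_map_eq_of_infinite f
  rcases hne.lt_or_gt with h | h
  · exact key i j hij h
  · exact key j i hij.symm h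

theorem OnBeta.stepB {σ : CState} (h : D.OnBeta σ) : D.OnBeta (D.stepB σ) := by
  obtain ⟨n, hn⟩ := h
  rcases n with _ | n
  · obtain ⟨N, hN, h⟩ := exists_pos_reduce_iterate_start0 (D := D)
    obtain ⟨N, rfl⟩ := Nat.exists_eq_succ_of_ne_zero hN.ne'
    refine ⟨N, ?_⟩
    have h' := reduce_stepB_congr (hn.trans h.symm)
    rwa [Function.iterate_succ_apply', stepB_step] at h'
  · refine ⟨n, ?_⟩
    have h' := reduce_stepB_congr hn
    rwa [Function.iterate_succ_apply', stepB_step] at h'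

theorem OnBeta.fstep {σ : CState} (h : D.OnBeta σ) : D.OnBeta (D.fstep σ) := by
  unfold StdDiagram.fstep
  split_ifs
  · exact h.step
  · exact h.stepB

theorem OnBeta.iterate_fstep {σ : CState} (h : D.OnBeta σ) (n : ℕ) :
    D.OnBeta (D.fstep^[n] σ) := by
  induction n with
  | zero => exact h
  | succ n ih => rw [Function.iterate_succ_apply']; exact ih.fstep

theorem not_reduce_iterate_eq_rev (m n : ℕ) :
    D.reduce (D.step^[m] start0) ≠ D.reduce (rev (D.step^[n] start0)) := by
  intro h
  rcases le_total m n with hmn | hmn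
  · obtain ⟨d, rfl⟩ := Nat.exists_eq_add_of_le' hmn
    apply reduce_iterate_step_ne_reduce_rev d (D.step^[m] start0)
    have h' := congrArg rev h
    rw [← Function.iterate_add_apply]
    simpa only [reduce_rev, rev_rev] using h'.symm
  · obtain ⟨d, rfl⟩ := Nat.exists_eq_add_of_le' hmn
    apply reduce_iterate_step_ne_reduce_rev d (D.step^[n] start0)
    rwa [← Function.iterate_add_apply]

theorem OnBeta.up_eq_up {σ τ : CState} (hσ : D.OnBeta σ) (hτ : D.OnBeta τ)
    (hpos : σ.pos % D.pz = τ.pos % D.pz) (htop : σ.top = τ.top) : σ.up = τ.up := by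
  obtain ⟨m, hm⟩ := hσ
  obtain ⟨n, hn⟩ := hτ
  by_contra hne
  apply not_reduce_iterate_eq_rev (D := D) m n
  rw [← hm, reduce_rev, ← hn, ← reduce_rev]
  simp only [reduce, rev, CState.mk.injEq]
  refine ⟨hpos, ?_, htop, trivial⟩
  cases hu : σ.up <;> cases hv : τ.up <;> simp_all

theorem onBeta_iterate_start0 (n : ℕ) : D.OnBeta (D.step^[n] start0) := ⟨n, rfl⟩

theorem OnBeta.upAt_iff {σ : CState} (h : D.OnBeta σ) (htop : σ.top = true) :
    D.UpAt σ.pos ↔ σ.up = true := by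
  constructor
  · rintro ⟨n, ht, hpos, hup⟩
    rw [h.up_eq_up (onBeta_iterate_start0 n) hpos.symm (htop.trans ht.symm), hup]
  · intro hup
    obtain ⟨n, hn⟩ := h
    simp only [reduce, CState.mk.injEq] at hn
    exact ⟨n, hn.2.2.1 ▸ htop, hn.1.symm, hn.2.1 ▸ hup⟩

theorem upAt_emod (k : ℤ) : D.UpAt (k % D.pz) ↔ D.UpAt k := by
  simp [UpAt]

theorem onBeta_spt (hconn : D.Connected) {k : ℕ} (hk : k < D.p) : D.OnBeta (D.spt k) := by
  obtain ⟨n, ht, hpos⟩ := hconn k hk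
  refine ⟨n, ?_⟩
  have hup := (onBeta_iterate_start0 (D := D) n).upAt_iff ht
  rw [← upAt_emod, hpos] at hup
  have hk' : (k : ℤ) % D.pz = k := by
    rw [← hpos, Int.emod_emod_of_dvd _ (dvd_refl _)]
  simp only [reduce, spt, CState.mk.injEq]
  refine ⟨hk'.trans hpos.symm, ?_, ht.symm, trivial⟩
  by_cases h : D.UpAt k <;> simp_all

/-- The contribution of a state to the algebraic intersection number. -/
def sign (σ : CState) : ℤ := if σ.top then (if σ.up then 1 else -1) else 0

/-- The height of a state, an up-crossing being counted only once it has been completed. -/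
def level (σ : CState) : ℤ := if σ.top && σ.up then σ.ht - 1 else σ.ht

theorem level_step (σ : CState) : level (D.step σ) = level σ + sign σ := by
  obtain ⟨x, u, t, y⟩ := σ
  cases u <;> cases t <;> simp only [step, level, sign] <;> split_ifs <;> simp_all <;> omega

theorem level_iterate_step (n : ℕ) (σ : CState) :
    level (D.step^[n] σ) = level σ + ∑ i ∈ Finset.range n, sign (D.step^[i] σ) := by
  induction n with
  | zero => simp
  | succ n ih => rw [Function.iterate_succ_apply', level_step, ih, Finset.sum_range_succ]; ring

/-- The step map modulo deck translations. -/
def stepMod (D : StdDiagram) (σ : CState) : CState := D.reduce (D.step σ)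

theorem iterate_stepMod (n : ℕ) (σ : CState) :
    D.stepMod^[n] (D.reduce σ) = D.reduce (D.step^[n] σ) := by
  induction n with
  | zero => rfl
  | succ n ih =>
    rw [Function.iterate_succ_apply', Function.iterate_succ_apply', ih, stepMod]
    exact reduce_step_congr (by simp [reduce])

theorem sign_reduce (σ : CState) : sign (D.reduce σ) = sign σ := rfl

theorem sum_sign_minimalPeriod (hconn : D.Connected) :
    ∑ i ∈ Finset.range (Function.minimalPeriod D.stepMod (D.reduce start0)),
      sign (D.step^[i] start0) = D.algInt := by
  set N := Function.minimalPeriod D.stepMod (D.reduce start0) with hN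
  have hNpos : 0 < N := by
    obtain ⟨n, hn, h⟩ := exists_pos_reduce_iterate_start0 (D := D)
    refine Function.IsPeriodicPt.minimalPeriod_pos hn ?_
    rw [Function.IsPeriodicPt, Function.IsFixedPt, iterate_stepMod, h]
  have hpz : D.pz = D.p := rfl
  have hsub : ∑ i ∈ Finset.range N, sign (D.step^[i] start0) =
      ∑ i ∈ (Finset.range N).filter (fun i => (D.step^[i] start0).top = true),
        sign (D.step^[i] start0) := by
    symm
    apply Finset.sum_filter_of_ne
    intro i _ h
    by_contra h'
    exact h (by simp [sign, h'])
  rw [hsub, algInt]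
  refine Finset.sum_bij (fun i _ => ((D.step^[i] start0).pos % D.pz).toNat) ?_ ?_ ?_ ?_
  · intro i _
    have h₀ := Int.emod_nonneg (D.step^[i] start0).pos D.pz_pos.ne'
    have h₁ := Int.emod_lt_of_pos (D.step^[i] start0).pos D.pz_pos
    rw [Finset.mem_range]
    omega
  · intro i hi j hj hij
    rw [Finset.mem_filter, Finset.mem_range] at hi hj
    have h₀ := Int.emod_nonneg (D.step^[i] start0).pos D.pz_pos.ne'
    have h₁ := Int.emod_nonneg (D.step^[j] start0).pos D.pz_pos.ne'
    have hpos : (D.step^[i] start0).pos % D.pz = (D.step^[j] start0).pos % D.pz := by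
      omega
    have htop := hi.2.trans hj.2.symm
    have hup := (onBeta_iterate_start0 i).up_eq_up (onBeta_iterate_start0 j) hpos htop
    refine (Function.iterate_eq_iterate_iff_of_lt_minimalPeriod hi.1 hj.1).1 ?_
    rw [iterate_stepMod, iterate_stepMod]
    simp only [reduce, hpos, htop, hup]
  · intro k hk
    obtain ⟨n, ht, hpos⟩ := hconn k (Finset.mem_range.1 hk)
    have h : D.reduce (D.step^[n % N] start0) = D.reduce (D.step^[n] start0) := by
      rw [← iterate_stepMod, ← iterate_stepMod, hN, Function.iterate_mod_minimalPeriod_eq]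
    simp only [reduce, CState.mk.injEq] at h
    refine ⟨n % N, ?_, ?_⟩
    · rw [Finset.mem_filter, Finset.mem_range]
      exact ⟨Nat.mod_lt _ hNpos, h.2.2.1.trans ht⟩
    · rw [h.1, hpos, Int.toNat_natCast]
  · intro i hi
    rw [Finset.mem_filter] at hi
    have h₀ := Int.emod_nonneg (D.step^[i] start0).pos D.pz_pos.ne'
    rw [Int.toNat_of_nonneg h₀]
    simp only [upAt_emod, (onBeta_iterate_start0 i).upAt_iff hi.2, sign, hi.2, if_true]

theorem iterate_step_start0_ne (hconn : D.Connected) (hA : D.algInt ≠ 0) {n : ℕ} (hn : 0 < n) :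
    D.step^[n] start0 ≠ start0 := by
  intro h
  have hper : Function.IsPeriodicPt D.stepMod n (D.reduce start0) := by
    rw [Function.IsPeriodicPt, Function.IsFixedPt, iterate_stepMod, h]
  obtain ⟨k, hk⟩ := hper.minimalPeriod_dvd
  set N := Function.minimalPeriod D.stepMod (D.reduce start0) with hN
  have hsum : ∀ k : ℕ, ∑ i ∈ Finset.range (N * k), sign (D.step^[i] start0) = k * D.algInt := by
    intro k
    induction k with
    | zero => simp
    | succ k ih =>
      rw [Nat.mul_succ, Finset.sum_range_add, ih, ← sum_sign_minimalPeriod hconn, ← hN]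
      have : ∀ i, sign (D.step^[N * k + i] start0) = sign (D.step^[i] start0) := by
        intro i
        rw [← sign_reduce (D := D), ← sign_reduce (D := D) (D.step^[i] start0),
          ← iterate_stepMod, ← iterate_stepMod, ← Function.iterate_mod_minimalPeriod_eq,
          ← hN, Nat.mul_add_mod, hN, Function.iterate_mod_minimalPeriod_eq]
      simp only [this]
      push_cast
      ring
  have hl := level_iterate_step (D := D) n start0
  rw [h, hk, hsum] at hl
  have hk0 : (k : ℤ) ≠ 0 := by
    rintro h0
    have : k = 0 := by exact_mod_cast h0
    subst this
    omega
  have : (k : ℤ) * D.algInt = 0 := by linarith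
  exact (mul_ne_zero hk0 hA) this

theorem OnBeta.iterate_step_ne (hconn : D.Connected) (hA : D.algInt ≠ 0) {σ : CState}
    (hσ : D.OnBeta σ) {n : ℕ} (hn : 0 < n) : D.step^[n] σ ≠ σ := by
  intro h
  obtain ⟨j, hj⟩ := hσ
  obtain ⟨a, b, rfl⟩ := reduce_eq_reduce_iff.1 hj.symm
  rw [iterate_step_translate] at h
  have h' := translate_injective a b h
  rw [← Function.iterate_add_apply, add_comm, Function.iterate_add_apply] at h'
  exact iterate_step_start0_ne hconn hA hn (step_injective.iterate j h')

theorem OnBeta.iterate_fstep_ne (hconn : D.Connected) (hA : D.algInt ≠ 0) {σ : CState}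
    (hσ : D.OnBeta σ) {n : ℕ} (hn : 0 < n) : D.fstep^[n] σ ≠ σ := by
  by_cases h : 0 < D.algInt
  · have : D.fstep = D.step := by funext τ; simp [StdDiagram.fstep, h]
    rw [this]
    exact hσ.iterate_step_ne hconn hA hn
  · have : D.fstep = D.stepB := by funext τ; simp [StdDiagram.fstep, h]
    rw [this]
    intro heq
    apply hσ.iterate_step_ne hconn hA hn
    have hinv : Function.LeftInverse D.step^[n] D.stepB^[n] :=
      Function.LeftInverse.iterate step_stepB n
    conv_lhs => rw [← heq]
    exact hinv σ

/-! ### Consecutive crossings of the line `y = 0` -/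

theorem isCross0_rev (σ : CState) : IsCross0 (rev σ) ↔ IsCross0 σ := Iff.rfl

theorem isCross0_translate (a : ℤ) (σ : CState) :
    IsCross0 (D.translate a 0 σ) ↔ IsCross0 σ := by
  simp [IsCross0, translate]

/-- The index of the row of rectangles containing the state. -/
def row (σ : CState) : ℤ := if σ.top then σ.ht - 1 else σ.ht

theorem row_step_of_nonneg {σ : CState} (h : 0 ≤ row σ) :
    0 ≤ row (D.step σ) ∨ IsCross0 (D.step σ) ∧ (D.step σ).up = false := by
  obtain ⟨x, u, t, y⟩ := σ
  revert h
  cases u <;> cases t <;> simp only [step, row, IsCross0] <;> split_ifs <;> simp_all <;> omega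

theorem row_step_of_neg {σ : CState} (h : row σ < 0) (h' : ¬ (IsCross0 σ ∧ σ.up = true)) :
    row (D.step σ) < 0 ∧ ¬ (IsCross0 (D.step σ) ∧ (D.step σ).up = false) := by
  obtain ⟨x, u, t, y⟩ := σ
  revert h h'
  cases u <;> cases t <;> simp only [step, row, IsCross0] <;> split_ifs <;> simp_all <;> omega

theorem row_of_isCross0 {σ : CState} (h : IsCross0 σ) : row σ = -1 := by
  simp [row, h.1, h.2]

theorem up_of_first_return_of_up {σ : CState} (hσ : IsCross0 σ) (hup : σ.up = true) {n : ℕ}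
    (hn : 1 ≤ n) (hfirst : ∀ i, 1 ≤ i → i < n → ¬ IsCross0 (D.step^[i] σ))
    (hret : IsCross0 (D.step^[n] σ)) : (D.step^[n] σ).up = false := by
  have hrow : ∀ i, 1 ≤ i → i < n → 0 ≤ row (D.step^[i] σ) := by
    intro i hi
    induction i, hi using Nat.le_induction with
    | base =>
      intro _
      simp [row, step, hσ.1, hσ.2, hup]
    | succ i hi ih =>
      intro hlt
      rw [Function.iterate_succ_apply']
      rcases row_step_of_nonneg (D := D) (ih (by omega)) with h | h
      · exact h
      · rw [← Function.iterate_succ_apply' D.step] at h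
        exact absurd h.1 (hfirst _ (by omega) hlt)
  obtain ⟨n, rfl⟩ := Nat.exists_eq_add_of_le' hn
  rcases Nat.eq_zero_or_pos n with rfl | hpos
  · simp [IsCross0, step, hσ.1, hup] at hret
  · have h := row_step_of_nonneg (D := D) (hrow n hpos (by omega))
    rw [← Function.iterate_succ_apply' D.step, row_of_isCross0 hret] at h
    rcases h with h | h
    · omega
    · exact h.2

theorem up_of_first_return_of_down {σ : CState} (hσ : IsCross0 σ) (hup : σ.up = false) {n : ℕ}
    (hn : 1 ≤ n) (hfirst : ∀ i, 1 ≤ i → i < n → ¬ IsCross0 (D.step^[i] σ))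
    (hret : IsCross0 (D.step^[n] σ)) : (D.step^[n] σ).up = true := by
  have hrow : ∀ i, i < n → row (D.step^[i + 1] σ) < 0 ∧
      ¬ (IsCross0 (D.step^[i + 1] σ) ∧ (D.step^[i + 1] σ).up = false) := by
    intro i
    induction i with
    | zero =>
      intro _
      exact row_step_of_neg (by rw [row_of_isCross0 hσ]; norm_num) (by simp [hup])
    | succ i ih =>
      intro hlt
      rw [Function.iterate_succ_apply']
      exact row_step_of_neg (ih (by omega)).1
        fun h => hfirst _ (by omega) (by omega) h.1
  obtain ⟨n, rfl⟩ := Nat.exists_eq_add_of_le' hn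
  have h := (hrow n (by omega)).2
  rw [not_and, Bool.not_eq_false] at h
  exact h hret

theorem up_of_first_return_step {σ : CState} (hσ : IsCross0 σ) {n : ℕ}
    (hn : 1 ≤ n) (hfirst : ∀ i, 1 ≤ i → i < n → ¬ IsCross0 (D.step^[i] σ))
    (hret : IsCross0 (D.step^[n] σ)) : (D.step^[n] σ).up = !σ.up := by
  cases hup : σ.up
  · exact up_of_first_return_of_down hσ hup hn hfirst hret
  · exact up_of_first_return_of_up hσ hup hn hfirst hret

theorem iterate_stepB_eq_rev (n : ℕ) (σ : CState) :
    D.stepB^[n] σ = rev (D.step^[n] (rev σ)) := by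
  induction n with
  | zero => simp
  | succ n ih =>
    rw [Function.iterate_succ_apply', ih, stepB_eq_rev_step_rev, rev_rev,
      Function.iterate_succ_apply']

/-- Consecutive crossings of the line `y = 0` have opposite directions. -/
theorem up_nxt0 {σ : CState} (hσ : IsCross0 σ) (hret : D.Returns0 σ) :
    (D.nxt0 σ).up = !σ.up := by
  have hmem : 1 ≤ D.ret0Steps σ ∧ IsCross0 (D.fstep^[D.ret0Steps σ] σ) := Nat.sInf_mem hret
  have hfirst : ∀ i, 1 ≤ i → i < D.ret0Steps σ → ¬ IsCross0 (D.fstep^[i] σ) :=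
    fun i hi hlt h => Nat.notMem_of_lt_sInf hlt ⟨hi, h⟩
  unfold nxt0
  generalize D.ret0Steps σ = n at hmem hfirst
  by_cases h : 0 < D.algInt
  · have : D.fstep = D.step := by funext τ; simp [StdDiagram.fstep, h]
    rw [this] at hmem hfirst ⊢
    exact up_of_first_return_step hσ hmem.1 hfirst hmem.2
  · have : D.fstep = D.stepB := by funext τ; simp [StdDiagram.fstep, h]
    rw [this] at hmem hfirst ⊢
    simp only [iterate_stepB_eq_rev, isCross0_rev] at hmem hfirst ⊢
    have := up_of_first_return_step (σ := rev σ) hσ hmem.1 hfirst hmem.2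
    simp [rev] at this ⊢
    exact this

theorem isCross0_nxt0 {σ : CState} (hret : D.Returns0 σ) : IsCross0 (D.nxt0 σ) :=
  (Nat.sInf_mem hret : 1 ≤ D.ret0Steps σ ∧ IsCross0 (D.fstep^[D.ret0Steps σ] σ)).2

theorem OnBeta.nxt0 {σ : CState} (h : D.OnBeta σ) : D.OnBeta (D.nxt0 σ) :=
  h.iterate_fstep _

theorem OnBeta.pos_nxt0_ne (hconn : D.Connected) (hA : D.algInt ≠ 0) {σ : CState}
    (h : D.OnBeta σ) (hσ : IsCross0 σ) (hret : D.Returns0 σ) : (D.nxt0 σ).pos ≠ σ.pos := by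
  intro hpos
  have hmem : 1 ≤ D.ret0Steps σ ∧ _ := Nat.sInf_mem hret
  have hcr := isCross0_nxt0 hret
  apply h.iterate_fstep_ne hconn hA hmem.1
  change D.nxt0 σ = σ
  have htop := hcr.1.trans hσ.1.symm
  ext
  · exact hpos
  · exact h.nxt0.up_eq_up h (by rw [hpos]) htop
  · exact htop
  · exact hcr.2.trans hσ.2.symm

theorem fstep_translate (a b : ℤ) (σ : CState) :
    D.fstep (D.translate a b σ) = D.translate a b (D.fstep σ) := by
  unfold fstep
  split_ifs
  · exact step_translate a b σ
  · exact stepB_translate a b σ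

theorem iterate_fstep_translate (a b : ℤ) (n : ℕ) (σ : CState) :
    D.fstep^[n] (D.translate a b σ) = D.translate a b (D.fstep^[n] σ) :=
  (Function.Semiconj.iterate_right (f := D.translate a b)
    (fun σ => (fstep_translate a b σ).symm) n σ).symm

theorem nxt0_translate (a : ℤ) (σ : CState) :
    D.nxt0 (D.translate a 0 σ) = D.translate a 0 (D.nxt0 σ) := by
  unfold nxt0 ret0Steps
  simp only [iterate_fstep_translate, isCross0_translate]

theorem OnBeta.translate_spt {σ : CState} (h : D.OnBeta σ) (hσ : IsCross0 σ) :
    D.translate (σ.pos / D.pz) 0 (D.spt (D.lab σ).toNat) = σ := by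
  have h₀ : ((D.lab σ).toNat : ℤ) = σ.pos % D.pz :=
    Int.toNat_of_nonneg (Int.emod_nonneg σ.pos D.pz_pos.ne')
  have hup := h.upAt_iff hσ.1
  rw [← upAt_emod, ← h₀] at hup
  ext
  · simp [translate, spt, h₀, Int.emod_add_mul_ediv]
  · simp only [translate, spt]
    cases hu : σ.up <;> simp_all
  · exact hσ.1.symm
  · simp [translate, spt, hσ.2]

theorem OnBeta.srcIsStart_lab {σ : CState} (h : D.OnBeta σ) (hσ : IsCross0 σ) :
    D.srcIsStart (D.lab σ).toNat ↔ ¬ (D.TrueUp σ ↔ σ.pos < (D.nxt0 σ).pos) := by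
  have hspt := h.translate_spt hσ
  generalize (D.lab σ).toNat = k at hspt ⊢
  conv_rhs => rw [← hspt, nxt0_translate]
  simp [srcIsStart, TrueUp, translate, spt]

end StdDiagram

/-- Lemma 3.6.  Let `b` (the `m₀`-th point) and `c'` (the `m₁`-th
point) be two consecutive turning points along `β̃ₛ`, and let `x_ℓ` be the
intersection points between them.  Then `gr(x_ℓ) = gr(b)` for `ℓ` even,
`gr(x_ℓ) = gr(b) + 1` for `ℓ` odd if `b` is a positive turning point, and
`gr(x_ℓ) = gr(b) - 1` for `ℓ` odd if `b` is a negative turning point. -/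
theorem maslov_grading_between_turning_points
    (D : StdDiagram) (hconn : D.Connected) (hA : D.algInt ≠ 0)
    (c : ℕ) (hc : c < D.p)
    (m0 m1 : ℕ) (hm0 : 1 ≤ m0) (hm : m0 < m1)
    (hret : ∀ i : ℕ, i ≤ m1 → D.Returns0 (D.seqSt c i))
    (h0 : D.TurningAt c m0) (h1 : D.TurningAt c m1)
    (hno : ∀ m : ℕ, m0 < m → m < m1 → ¬ D.TurningAt c m) :
    ∀ ℓ : ℕ, ℓ ≤ m1 - m0 →
      (ℓ % 2 = 0 → D.grPartial c (m0 + ℓ) = D.grPartial c m0) ∧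
      (ℓ % 2 = 1 →
        (D.PosTurningAt c m0 → D.grPartial c (m0 + ℓ) = D.grPartial c m0 + 1) ∧
        (D.NegTurningAt c m0 → D.grPartial c (m0 + ℓ) = D.grPartial c m0 - 1)) := by
  have hbeta : ∀ i, D.OnBeta (D.seqSt c i) := by
    intro i
    induction i with
    | zero => exact StdDiagram.onBeta_spt hconn hc
    | succ i ih =>
      rw [StdDiagram.seqSt, Function.iterate_succ_apply']
      exact ih.nxt0
  have hsucc : ∀ i, D.seqSt c (i + 1) = D.nxt0 (D.seqSt c i) := fun i =>
    Function.iterate_succ_apply' _ _ _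
  have hcross : ∀ i, i ≤ m1 → StdDiagram.IsCross0 (D.seqSt c i) := by
    intro i hi
    rcases i with _ | i
    · exact ⟨rfl, rfl⟩
    · rw [hsucc]
      exact StdDiagram.isCross0_nxt0 (hret i (by omega))
  have hne : ∀ i, i ≤ m1 → D.posAt c (i + 1) ≠ D.posAt c i := by
    intro i hi
    rw [StdDiagram.posAt, hsucc]
    exact (hbeta i).pos_nxt0_ne hconn hA (hcross i hi) (hret i hi)
  have hsrc : ∀ i, i ≤ m1 → (D.srcIsStartAt c i ↔
      ¬ (D.TrueUp (D.seqSt c i) ↔ D.posAt c i < D.posAt c (i + 1))) := by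
    intro i hi
    have h := (hbeta i).srcIsStart_lab (hcross i hi)
    rwa [← hsucc] at h
  have hup : ∀ i, i ≤ m1 → (D.TrueUp (D.seqSt c (i + 1)) ↔ ¬ D.TrueUp (D.seqSt c i)) := by
    intro i hi
    rw [StdDiagram.TrueUp, StdDiagram.TrueUp, hsucc,
      StdDiagram.up_nxt0 (hcross i hi) (hret i hi)]
    cases (D.seqSt c i).up <;> simp
  have hturn : D.srcIsStartAt c m0 ↔ D.srcIsStartAt c (m0 - 1) := by
    obtain ⟨k, rfl⟩ := Nat.exists_eq_add_of_le' hm0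
    rw [hsrc _ (by omega), Nat.add_sub_cancel, hsrc k (by omega), hup k (by omega)]
    have h := h0.2
    rw [Nat.add_sub_cancel] at h
    have : D.posAt c (k + 1) < D.posAt c (k + 1 + 1) ↔ ¬ D.posAt c k < D.posAt c (k + 1) := by
      omega
    tauto
  have halt : ∀ m, m0 ≤ m → m + 1 < m1 →
      (D.srcIsStartAt c (m + 1) ↔ ¬ D.srcIsStartAt c m) := by
    intro m hle hlt
    rw [hsrc _ (by omega), hsrc m (by omega), hup m (by omega)]
    have h := hno (m + 1) (by omega) hlt
    have h₁ := hne m (by omega)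
    have h₂ := hne (m + 1) (by omega)
    rw [StdDiagram.TurningAt, Nat.add_sub_cancel] at h
    have : D.posAt c (m + 1) < D.posAt c (m + 1 + 1) ↔ D.posAt c m < D.posAt c (m + 1) := by
      omega
    tauto
  have hpar : ∀ l, l < m1 - m0 →
      (D.srcIsStartAt c (m0 + l) ↔ (l % 2 = 0 ↔ D.srcIsStartAt c m0)) := by
    intro l
    induction l with
    | zero => simp
    | succ l ih =>
      intro hl
      rw [← add_assoc, halt _ (by omega) (by omega), ih (by omega)]
      have : (l + 1) % 2 = 0 ↔ ¬ l % 2 = 0 := by omega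
      rw [this, not_iff]
  have hgr : ∀ l, l ≤ m1 - m0 → D.grPartial c (m0 + l) = D.grPartial c m0 +
      if l % 2 = 0 then 0 else if D.srcIsStartAt c m0 then -1 else 1 := by
    intro l
    induction l with
    | zero => simp
    | succ l ih =>
      intro hl
      have hs : D.grPartial c (m0 + (l + 1)) = D.grPartial c (m0 + l) +
          if D.srcIsStartAt c (m0 + l) then -1 else 1 := by
        rw [StdDiagram.grPartial, ← add_assoc, Finset.sum_range_succ, ← StdDiagram.grPartial]
      rw [hs, ih (by omega)]
      have := hpar l (by omega)
      rcases Nat.mod_two_eq_zero_or_one l with h | h <;>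
        by_cases hS : D.srcIsStartAt c m0 <;> simp_all [Nat.add_mod]
  intro l hl
  rw [hgr l hl]
  refine ⟨fun h => by simp [h], fun h => ⟨fun hP => ?_, fun hN => ?_⟩⟩
  · simp [h, hturn, hP.2]
  · simp [h, hturn, hN.2, sub_eq_add_neg]

end

end OneOneKnot
end
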